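/- arXiv:2105.00850 — 5 statements merged into one kernel-verified Lean document; each statement's English description precedes it below -/
import Mathlib

section
/- There exists a universal constant ξ > 0 such that for every n ∈ ℕ with n ≥ 1, every t ∈ ℤ and every ε ∈ [-1,1] satisfying B(n,ε)(t) > 0, |t| ≤ n^{3/5} and |ε| ≤ n^{-2/5}, it holds that |B(n,ε)(t) − c₀| ≤ ξ·(ε²·|t| + 1/n + |t|³/n² + ε⁴·n)·c₀, where c₀ := √(2/π)·(1/√n)·e^{-(t-εn)²/(2n)}. -/
noncomputable def binPMF (n : ℕ) (ε : ℝ) (k : ℤ) : ℝ :=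
  if ((n : ℤ) + k) % 2 = 0 ∧ -(n : ℤ) ≤ k ∧ k ≤ (n : ℤ) then
    (n.choose (((n : ℤ) + k) / 2).toNat : ℝ) *
      ((1 + ε) / 2) ^ (((n : ℤ) + k) / 2).toNat *
      ((1 - ε) / 2) ^ (((n : ℤ) - k) / 2).toNat
  else 0

noncomputable def binTail (n : ℕ) (ε : ℝ) (k : ℤ) : ℝ :=
  ∑ t ∈ Finset.Icc k (n : ℤ), binPMF n ε t

open Real Filter Topology in
theorem log_stirlingSeq_le {m : ℕ} (hm : 1 ≤ m) :
    log (Stirling.stirlingSeq m) ≤ log (√π) + 1 / (12 * m) := by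
  have hmono : Monotone fun i : ℕ ↦
      log (Stirling.stirlingSeq (i + 1)) - 1 / (12 * ((i + 1 : ℕ) : ℝ)) := by
    refine monotone_nat_of_le_succ fun i ↦ ?_
    have h := Stirling.log_stirlingSeq_sdiff_le (i + 1)
    have hi : (0 : ℝ) ≤ i := i.cast_nonneg
    have e : 1 / (12 * ((i + 1 : ℕ) : ℝ) * ((i + 1 : ℕ) + 1)) =
        1 / (12 * ((i + 1 : ℕ) : ℝ)) - 1 / (12 * ((i + 1 + 1 : ℕ) : ℝ)) := by
      push_cast
      field_simp
      ring
    linarith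
  have hlim : Tendsto (fun i : ℕ ↦
      log (Stirling.stirlingSeq (i + 1)) - 1 / (12 * ((i + 1 : ℕ) : ℝ))) atTop
      (𝓝 (log (√π) - 0)) := by
    refine Tendsto.sub ?_ ?_
    · exact ((Stirling.tendsto_stirlingSeq_sqrt_pi.log (by positivity)).comp
        (tendsto_add_atTop_nat 1))
    · have h : Tendsto (fun i : ℕ ↦ 1 / (12 : ℝ) * (1 / ((i : ℝ) + 1))) atTop
          (𝓝 (1 / (12 : ℝ) * 0)) := tendsto_one_div_add_atTop_nhds_zero_nat.const_mul _
      rw [mul_zero] at h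
      refine h.congr fun i ↦ ?_
      push_cast
      rw [one_div_mul_one_div]
  have h := hmono.ge_of_tendsto hlim (m - 1)
  simp only [Nat.sub_add_cancel hm] at h
  linarith

open Real in
/-- Two-sided Stirling approximation with an explicit error term. -/
theorem exists_log_factorial_eq {m : ℕ} (hm : 1 ≤ m) :
    ∃ r : ℝ, 0 ≤ r ∧ r ≤ 1 / (12 * m) ∧
      log (m.factorial : ℝ) = m * log m - m + log m / 2 + log (2 * π) / 2 + r := by
  refine ⟨log (m.factorial : ℝ) - (m * log m - m + log m / 2 + log (2 * π) / 2), ?_, ?_, by ring⟩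
  · linarith [Stirling.le_log_factorial_stirling (n := m) (by omega)]
  · have h := log_stirlingSeq_le hm
    have hm' : (0 : ℝ) < m := by exact_mod_cast hm
    rw [Stirling.log_stirlingSeq_formula, log_sqrt pi_pos.le, log_mul two_ne_zero hm'.ne',
      log_div hm'.ne' (exp_pos 1).ne', log_exp] at h
    rw [log_mul two_ne_zero pi_pos.ne']
    linarith

open Real in
theorem abs_log_add_log_add_sq_le {x : ℝ} (hx : |x| ≤ 4 / 5) :
    |log (1 + x) + log (1 - x) + x ^ 2| ≤ 4 * x ^ 4 := by
  obtain ⟨h1, h2⟩ := abs_le.mp hx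
  have hsq : x ^ 2 ≤ 16 / 25 := by nlinarith
  have habs : |x ^ 2| = x ^ 2 := abs_of_nonneg (sq_nonneg x)
  have h := abs_log_sub_add_sum_range_le (x := x ^ 2) (by rw [habs]; linarith) 1
  rw [habs] at h
  norm_num at h
  rw [← log_mul (by linarith) (by linarith), show (1 + x) * (1 - x) = 1 - x ^ 2 by ring, add_comm]
  refine h.trans ?_
  rw [div_le_iff₀ (by linarith)]
  nlinarith [mul_nonneg (sq_nonneg (x ^ 2)) (sub_nonneg.2 hsq)]

open Real in
theorem abs_log_sub_log_sub_two_mul_le {x : ℝ} (hx : |x| ≤ 4 / 5) :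
    |log (1 + x) - log (1 - x) - 2 * x| ≤ 10 * |x| ^ 3 := by
  have key : ∀ y : ℝ, |y| ≤ 4 / 5 → |y + y ^ 2 / 2 + log (1 - y)| ≤ 5 * |y| ^ 3 := by
    intro y hy
    have h := abs_log_sub_add_sum_range_le (x := y) (by linarith) 2
    norm_num [Finset.sum_range_succ] at h
    refine h.trans ?_
    rw [div_le_iff₀ (by linarith)]
    nlinarith [pow_nonneg (abs_nonneg y) 3]
  have h1 := key x hx
  have h2 := key (-x) (by rwa [abs_neg])
  rw [abs_neg, sub_neg_eq_add] at h2
  rw [show log (1 + x) - log (1 - x) - 2 * x =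
    (-x + (-x) ^ 2 / 2 + log (1 + x)) - (x + x ^ 2 / 2 + log (1 - x)) by ring]
  exact (abs_sub _ _).trans (by linarith)

open Real in
theorem abs_exp_sub_one_le_mul_exp_abs (x : ℝ) : |exp x - 1| ≤ |x| * exp |x| := by
  rcases le_total 0 x with hx | hx
  · rw [abs_of_nonneg (by linarith [one_le_exp hx]), abs_of_nonneg hx]
    have h := mul_le_mul_of_nonneg_right (add_one_le_exp (-x)) (exp_pos x).le
    rw [← exp_add, neg_add_cancel, exp_zero] at h
    linarith
  · rw [abs_of_nonpos (by linarith [exp_le_one_iff.2 hx]), abs_of_nonpos hx]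
    nlinarith [add_one_le_exp x, one_le_exp (neg_nonneg.2 hx)]

noncomputable def gaussApprox (n : ℕ) (ε t : ℝ) : ℝ :=
  Real.sqrt (2 / Real.pi) * (1 / Real.sqrt n) * Real.exp (-(t - ε * n) ^ 2 / (2 * n))

theorem gaussApprox_pos {n : ℕ} (hn : 1 ≤ n) (ε t : ℝ) : 0 < gaussApprox n ε t := by
  have : (0 : ℝ) < n := by exact_mod_cast hn
  unfold gaussApprox
  positivity

theorem log_gaussApprox {n : ℕ} (hn : 1 ≤ n) (ε t : ℝ) :
    Real.log (gaussApprox n ε t) =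
      (Real.log 2 - Real.log Real.pi) / 2 - Real.log n / 2 - (t - ε * n) ^ 2 / (2 * n) := by
  have hn' : (0 : ℝ) < n := by exact_mod_cast hn
  have := Real.pi_pos
  unfold gaussApprox
  rw [Real.log_mul (by positivity) (by positivity), Real.log_mul (by positivity) (by positivity),
    Real.log_exp, Real.log_sqrt (by positivity), Real.log_div (by positivity) (by positivity),
    one_div, Real.log_inv, Real.log_sqrt hn'.le]
  ring

/-- The relative error of the normal approximation. -/
noncomputable def gaussError (n : ℕ) (ε t : ℝ) : ℝ :=
  ε ^ 2 * |t| + 1 / n + |t| ^ 3 / (n : ℝ) ^ 2 + ε ^ 4 * n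

theorem binPMF_one_le_one {ε : ℝ} (hε : ε ∈ Set.Icc (-1 : ℝ) 1) (t : ℤ) :
    binPMF 1 ε t ≤ 1 := by
  obtain ⟨h1, h2⟩ := hε
  unfold binPMF
  split_ifs with h
  · obtain ⟨h3, h4, h5⟩ := h
    have : t = 1 ∨ t = -1 := by push_cast at *; omega
    rcases this with rfl | rfl <;> norm_num <;> linarith
  · exact zero_le_one

theorem exists_of_binPMF_pos {n : ℕ} {ε : ℝ} {t : ℤ} (h : 0 < binPMF n ε t) :
    ∃ k l : ℕ, n = k + l ∧ t = k - l ∧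
      binPMF n ε t = ((k + l).choose k : ℝ) * ((1 + ε) / 2) ^ k * ((1 - ε) / 2) ^ l := by
  unfold binPMF at h ⊢
  split_ifs at h ⊢ with hc
  · obtain ⟨h1, h2, h3⟩ := hc
    have e : n = (((n : ℤ) + t) / 2).toNat + (((n : ℤ) - t) / 2).toNat := by omega
    refine ⟨(((n : ℤ) + t) / 2).toNat, (((n : ℤ) - t) / 2).toNat, e, by omega, ?_⟩
    rw [← e]
  · exact absurd h (lt_irrefl 0)

theorem abs_stirling_remainder_le {n a ε rn rk rl X₁ X₂ Y₁ Y₂ : ℝ} (hn : 0 < n)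
    (ha : |a| ≤ 4 / 5) (hn0 : 0 ≤ rn) (hrn : rn ≤ 1 / n) (hk0 : 0 ≤ rk) (hrk : rk ≤ 1 / n)
    (hl0 : 0 ≤ rl) (hrl : rl ≤ 1 / n) (hx1 : |X₁| ≤ 4 * a ^ 4) (hx2 : |X₂| ≤ 10 * |a| ^ 3)
    (hy1 : |Y₁| ≤ 4 * ε ^ 4) (hy2 : |Y₂| ≤ 10 * |ε| ^ 3) :
    |(rn - rk - rl) + a ^ 2 / 2 - X₁ / 2 + n * ((Y₁ - X₁) / 2 + (a * Y₂ - a * X₂) / 2)| ≤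
      10 / n + 3 * a ^ 2 + n * (7 * a ^ 4 + 2 * ε ^ 4 + 5 * (|a| * |ε| ^ 3)) := by
  obtain ⟨ha1, ha2⟩ := abs_le.mp ha
  have ha4 : a ^ 4 ≤ a ^ 2 := by nlinarith [sq_nonneg a, show a ^ 2 ≤ 1 by nlinarith]
  have h4 : |a| * |a| ^ 3 = a ^ 4 := by
    rw [← pow_succ', Even.pow_abs (by decide)]
  have hax : |a * X₂| ≤ 10 * a ^ 4 := by
    rw [abs_mul, ← h4]
    linarith [mul_le_mul_of_nonneg_left hx2 (abs_nonneg a)]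
  have hay : |a * Y₂| ≤ 10 * (|a| * |ε| ^ 3) := by
    rw [abs_mul]
    linarith [mul_le_mul_of_nonneg_left hy2 (abs_nonneg a)]
  obtain ⟨hx3, hx4⟩ := abs_le.mp hx1
  obtain ⟨hy3, hy4⟩ := abs_le.mp hy1
  obtain ⟨hax1, hax2⟩ := abs_le.mp hax
  obtain ⟨hay1, hay2⟩ := abs_le.mp hay
  have hinner : |(Y₁ - X₁) / 2 + (a * Y₂ - a * X₂) / 2| ≤
      7 * a ^ 4 + 2 * ε ^ 4 + 5 * (|a| * |ε| ^ 3) :=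
    abs_le.mpr ⟨by linarith, by linarith⟩
  have hmul := mul_le_mul_of_nonneg_left hinner hn.le
  rw [← abs_of_pos hn, ← abs_mul, abs_of_pos hn] at hmul
  obtain ⟨hm1, hm2⟩ := abs_le.mp hmul
  have hdiv : 10 / n = 10 * (1 / n) := by ring
  have hpos : 0 < 1 / n := by positivity
  exact abs_le.mpr ⟨by linarith [sq_nonneg a], by linarith [sq_nonneg a]⟩

open Real in
/-- The logarithm of a binomial probability, up to the Stirling remainders. -/
theorem log_binomial_sub_log_gaussApprox {k l : ℕ} (hk : 1 ≤ k) (hl : 1 ≤ l) {a ε : ℝ}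
    (ha : |a| ≤ 4 / 5) (hε : |ε| ≤ 4 / 5) (hat : a * ((k + l : ℕ) : ℝ) = k - l) :
    |log (((k + l).choose k : ℝ) * ((1 + ε) / 2) ^ k * ((1 - ε) / 2) ^ l) -
        log (gaussApprox (k + l) ε (k - l))| ≤
      10 / ((k + l : ℕ) : ℝ) + 3 * a ^ 2 +
        ((k + l : ℕ) : ℝ) * (7 * a ^ 4 + 2 * ε ^ 4 + 5 * (|a| * |ε| ^ 3)) := by
  obtain ⟨ha1, ha2⟩ := abs_le.mp ha
  obtain ⟨he1, he2⟩ := abs_le.mp hε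
  obtain ⟨rn, hn0, hn1, hn⟩ := exists_log_factorial_eq (m := k + l) (by omega)
  obtain ⟨rk, hk0, hk1, hk2⟩ := exists_log_factorial_eq hk
  obtain ⟨rl, hl0, hl1, hl2⟩ := exists_log_factorial_eq hl
  have hfac : (((k + l).choose k : ℕ) : ℝ) * (k.factorial : ℝ) * (l.factorial : ℝ) =
      ((k + l).factorial : ℝ) := by
    rw [Nat.choose_symm_add]
    exact_mod_cast Nat.add_choose_mul_factorial_mul_factorial k l
  have hchoose : (0 : ℝ) < ((k + l).choose k : ℝ) := by
    exact_mod_cast Nat.choose_pos (Nat.le_add_right k l)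
  have hlogc : log ((k + l).choose k : ℝ) + log (k.factorial : ℝ) + log (l.factorial : ℝ) =
      log ((k + l).factorial : ℝ) := by
    rw [← hfac, log_mul (by positivity) (by positivity), log_mul (by positivity) (by positivity)]
  rw [log_gaussApprox (by omega)]
  have hsum : ((k + l : ℕ) : ℝ) = k + l := by push_cast; ring
  have hkpos : (0 : ℝ) < k := by exact_mod_cast hk
  have hlpos : (0 : ℝ) < l := by exact_mod_cast hl
  set n : ℝ := ((k + l : ℕ) : ℝ) with hndef
  have hnpos : 0 < n := by linarith
  have hk3 : (k : ℝ) = n * (1 + a) / 2 := by linarith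
  have hl3 : (l : ℝ) = n * (1 - a) / 2 := by linarith
  have hna1 : n * (-(4 / 5)) ≤ n * a := mul_le_mul_of_nonneg_left ha1 hnpos.le
  have hna2 : n * a ≤ n * (4 / 5) := mul_le_mul_of_nonneg_left ha2 hnpos.le
  have hlogk : log (k : ℝ) = log n + log (1 + a) - log 2 := by
    rw [hk3, log_div (mul_ne_zero hnpos.ne' (by linarith)) two_ne_zero,
      log_mul hnpos.ne' (by linarith)]
  have hlogl : log (l : ℝ) = log n + log (1 - a) - log 2 := by
    rw [hl3, log_div (mul_ne_zero hnpos.ne' (by linarith)) two_ne_zero,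
      log_mul hnpos.ne' (by linarith)]
  have hlogb : log (((k + l).choose k : ℝ) * ((1 + ε) / 2) ^ k * ((1 - ε) / 2) ^ l) =
      log ((k + l).choose k : ℝ) + k * (log (1 + ε) - log 2) + l * (log (1 - ε) - log 2) := by
    have h1 : (0 : ℝ) < (1 + ε) / 2 := by linarith
    have h2 : (0 : ℝ) < (1 - ε) / 2 := by linarith
    rw [log_mul (by positivity) (by positivity), log_mul (by positivity) (by positivity), log_pow,
      log_pow, log_div (by linarith) two_ne_zero, log_div (by linarith) two_ne_zero]
  have hrk : rk ≤ 1 / n :=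
    hk1.trans (one_div_le_one_div_of_le hnpos (by linarith))
  have hrl : rl ≤ 1 / n :=
    hl1.trans (one_div_le_one_div_of_le hnpos (by linarith))
  have hrn : rn ≤ 1 / n :=
    hn1.trans (one_div_le_one_div_of_le hnpos (by linarith))
  have hx1 := abs_log_add_log_add_sq_le ha
  have hx2 := abs_log_sub_log_sub_two_mul_le ha
  have hy1 := abs_log_add_log_add_sq_le hε
  have hy2 := abs_log_sub_log_sub_two_mul_le hε
  set X₁ := log (1 + a) + log (1 - a) + a ^ 2 with hX₁
  set X₂ := log (1 + a) - log (1 - a) - 2 * a with hX₂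
  set Y₁ := log (1 + ε) + log (1 - ε) + ε ^ 2 with hY₁
  set Y₂ := log (1 + ε) - log (1 - ε) - 2 * ε with hY₂
  have hgauss : ((k : ℝ) - l - ε * n) ^ 2 / (2 * n) = n * (a - ε) ^ 2 / 2 := by
    rw [← hat]
    field_simp
  have hlogpi : log (2 * π) = log 2 + log π := log_mul two_ne_zero pi_pos.ne'
  have hD : log (((k + l).choose k : ℝ) * ((1 + ε) / 2) ^ k * ((1 - ε) / 2) ^ l) -
      ((log 2 - log π) / 2 - log n / 2 - ((k : ℝ) - l - ε * n) ^ 2 / (2 * n)) =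
      (rn - rk - rl) + a ^ 2 / 2 - X₁ / 2 +
        n * ((Y₁ - X₁) / 2 + (a * Y₂ - a * X₂) / 2) := by
    have hc : log ((k + l).choose k : ℝ) =
      log ((k + l).factorial : ℝ) - log (k.factorial : ℝ) - log (l.factorial : ℝ) := by linarith
    rw [hlogb, hgauss, hc, hn, hk2, hl2, hlogk, hlogl, hlogpi, hk3, hl3]
    simp only [hX₁, hX₂, hY₁, hY₂]
    ring
  rw [hD]
  exact abs_stirling_remainder_le hnpos ha hn0 hrn hk0 hrk hl0 hrl hx1 hx2 hy1 hy2

theorem int_sq_le_abs_cube (t : ℤ) : (t : ℝ) ^ 2 ≤ |(t : ℝ)| ^ 3 := by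
  rcases eq_or_ne t 0 with rfl | h
  · simp
  · have h1 : (1 : ℝ) ≤ |(t : ℝ)| := by exact_mod_cast Int.one_le_abs h
    rw [← sq_abs]
    exact pow_le_pow_right₀ h1 (by norm_num)

theorem log_error_le_gaussError {n : ℕ} (hn : 1 ≤ n) {t : ℤ} {a ε : ℝ}
    (ha : |a| ≤ 1) (hε : |ε| ≤ 1) (hat : a * n = t) :
    10 / (n : ℝ) + 3 * a ^ 2 + n * (7 * a ^ 4 + 2 * ε ^ 4 + 5 * (|a| * |ε| ^ 3)) ≤
      10 * gaussError n ε t := by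
  have hn' : (0 : ℝ) < n := by exact_mod_cast hn
  have ht : |(t : ℝ)| = |a| * n := by rw [← hat, abs_mul, abs_of_pos hn']
  have hsq : a ^ 2 ≤ |(t : ℝ)| ^ 3 / (n : ℝ) ^ 2 := by
    rw [le_div_iff₀ (by positivity), ← mul_pow, hat]
    exact int_sq_le_abs_cube t
  have hcube : |(t : ℝ)| ^ 3 / (n : ℝ) ^ 2 = |a| ^ 3 * n := by
    rw [ht]
    field_simp
  have hfour : n * a ^ 4 ≤ |a| ^ 3 * n := by
    have h4 : a ^ 4 = |a| * |a| ^ 3 := by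
      rw [← pow_succ', Even.pow_abs (by decide)]
    rw [h4]
    nlinarith [mul_nonneg (mul_nonneg (pow_nonneg (abs_nonneg a) 3) hn'.le) (sub_nonneg.2 ha)]
  have hmix : n * (|a| * |ε| ^ 3) ≤ ε ^ 2 * |(t : ℝ)| := by
    rw [ht, ← sq_abs ε]
    nlinarith [mul_nonneg (mul_nonneg (mul_nonneg (abs_nonneg a) hn'.le) (sq_nonneg |ε|))
      (sub_nonneg.2 hε)]
  unfold gaussError
  have h0 : 0 ≤ ε ^ 4 * n := by positivity
  have h1 : 0 ≤ ε ^ 2 * |(t : ℝ)| := by positivity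
  have hdiv : 10 / (n : ℝ) = 10 * (1 / n) := by ring
  linarith

theorem gaussError_le_four {n : ℕ} (hn : 1 ≤ n) {ε t : ℝ}
    (ht : |t| ≤ (n : ℝ) ^ ((3 : ℝ) / 5)) (hε : |ε| ≤ (n : ℝ) ^ (-(2 : ℝ) / 5)) :
    gaussError n ε t ≤ 4 := by
  have hn1 : (1 : ℝ) ≤ n := by exact_mod_cast hn
  have hn' : (0 : ℝ) < n := by linarith
  have hε2 : ε ^ 2 ≤ (n : ℝ) ^ (-(4 : ℝ) / 5) := by
    rw [← sq_abs]
    refine (pow_le_pow_left₀ (abs_nonneg _) hε 2).trans_eq ?_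
    rw [← Real.rpow_mul_natCast hn'.le]
    norm_num
  have hε4 : ε ^ 4 ≤ (n : ℝ) ^ (-(8 : ℝ) / 5) := by
    rw [← Even.pow_abs (by decide : Even 4)]
    refine (pow_le_pow_left₀ (abs_nonneg _) hε 4).trans_eq ?_
    rw [← Real.rpow_mul_natCast hn'.le]
    norm_num
  have ht3 : |t| ^ 3 ≤ (n : ℝ) ^ ((9 : ℝ) / 5) := by
    refine (pow_le_pow_left₀ (abs_nonneg _) ht 3).trans_eq ?_
    rw [← Real.rpow_mul_natCast hn'.le]
    norm_num
  have h1 : ε ^ 2 * |t| ≤ 1 := by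
    calc ε ^ 2 * |t| ≤ (n : ℝ) ^ (-(4 : ℝ) / 5) * (n : ℝ) ^ ((3 : ℝ) / 5) := by gcongr
      _ = (n : ℝ) ^ (-(1 : ℝ) / 5) := by rw [← Real.rpow_add hn']; norm_num
      _ ≤ 1 := Real.rpow_le_one_of_one_le_of_nonpos hn1 (by norm_num)
  have h2 : 1 / (n : ℝ) ≤ 1 := by rw [div_le_one hn']; exact hn1
  have h3 : |t| ^ 3 / (n : ℝ) ^ 2 ≤ 1 := by
    rw [div_le_one (by positivity)]
    refine ht3.trans ?_
    rw [← Real.rpow_natCast]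
    exact Real.rpow_le_rpow_of_exponent_le hn1 (by norm_num)
  have h4 : ε ^ 4 * n ≤ 1 := by
    calc ε ^ 4 * n ≤ (n : ℝ) ^ (-(8 : ℝ) / 5) * (n : ℝ) ^ (1 : ℝ) := by
          rw [Real.rpow_one]; gcongr
      _ = (n : ℝ) ^ (-(3 : ℝ) / 5) := by rw [← Real.rpow_add hn']; norm_num
      _ ≤ 1 := Real.rpow_le_one_of_one_le_of_nonpos hn1 (by norm_num)
  unfold gaussError
  linarith

theorem le_four_fifths_of_le_rpow {n : ℕ} (hn : 2 ≤ n) {x : ℝ}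
    (hx : x ≤ (n : ℝ) ^ (-(2 : ℝ) / 5)) : x ≤ 4 / 5 := by
  have hn2 : (2 : ℝ) ≤ n := by exact_mod_cast hn
  refine hx.trans ?_
  have h0 : (0 : ℝ) ≤ (n : ℝ) ^ (-(2 : ℝ) / 5) := by positivity
  refine le_of_pow_le_pow_left₀ (n := 5) (by norm_num) (by norm_num) ?_
  have e : ((n : ℝ) ^ (-(2 : ℝ) / 5)) ^ 5 = ((n : ℝ) ^ 2)⁻¹ := by
    rw [← Real.rpow_mul_natCast (by positivity), ← Real.rpow_natCast,
      ← Real.rpow_neg (by positivity)]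
    norm_num
  rw [e]
  calc ((n : ℝ) ^ 2)⁻¹ ≤ ((2 : ℝ) ^ 2)⁻¹ := by gcongr
    _ ≤ (4 / 5) ^ 5 := by norm_num

theorem gaussError_nonneg (n : ℕ) (ε t : ℝ) : 0 ≤ gaussError n ε t := by
  unfold gaussError
  positivity

theorem abs_binPMF_sub_gaussApprox_le {n : ℕ} (hn : 2 ≤ n) {t : ℤ} {ε : ℝ}
    (hpos : 0 < binPMF n ε t) (ht : |(t : ℝ)| ≤ (n : ℝ) ^ ((3 : ℝ) / 5))
    (hε : |ε| ≤ (n : ℝ) ^ (-(2 : ℝ) / 5)) :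
    |binPMF n ε t - gaussApprox n ε t| ≤
      10 * Real.exp 40 * gaussError n ε t * gaussApprox n ε t := by
  have hn' : (0 : ℝ) < n := by exact_mod_cast (by omega : 0 < n)
  have hε' := le_four_fifths_of_le_rpow hn hε
  set a : ℝ := t / n with ha_def
  have hat : a * n = t := div_mul_cancel₀ _ hn'.ne'
  have ha : |a| ≤ 4 / 5 := by
    refine le_four_fifths_of_le_rpow hn ?_
    rw [ha_def, abs_div, abs_of_pos hn', div_le_iff₀ hn']
    refine ht.trans_eq ?_
    rw [← Real.rpow_add_one hn'.ne']
    norm_num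
  have hE := gaussError_le_four (by omega) ht hε
  have hE0 := gaussError_nonneg n ε t
  have hle := log_error_le_gaussError (by omega) (ha.trans (by norm_num))
    (hε'.trans (by norm_num)) hat
  have hg := gaussApprox_pos (n := n) (by omega) ε t
  have hlog : |Real.log (binPMF n ε t) - Real.log (gaussApprox n ε t)| ≤
      10 * gaussError n ε t := by
    refine le_trans ?_ hle
    obtain ⟨k, l, rfl, rfl, hb⟩ := exists_of_binPMF_pos hpos
    obtain ⟨ha1, ha2⟩ := abs_le.mp ha
    push_cast at hat hn'
    have hk : 1 ≤ k := Nat.one_le_iff_ne_zero.2 fun h ↦ by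
      subst h; push_cast at hat hn'; nlinarith
    have hl : 1 ≤ l := Nat.one_le_iff_ne_zero.2 fun h ↦ by
      subst h; push_cast at hat hn'; nlinarith
    rw [hb]
    have h := log_binomial_sub_log_gaussApprox hk hl ha hε' (by push_cast; exact hat)
    rwa [show (((k : ℤ) - (l : ℤ) : ℤ) : ℝ) = (k : ℝ) - l by push_cast; ring]
  set D := Real.log (binPMF n ε t) - Real.log (gaussApprox n ε t) with hD
  have hb : binPMF n ε t = gaussApprox n ε t * Real.exp D := by
    rw [hD, Real.exp_sub, Real.exp_log hpos, Real.exp_log hg, mul_div_cancel₀ _ hg.ne']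
  rw [hb, show gaussApprox n ε t * Real.exp D - gaussApprox n ε t =
    (Real.exp D - 1) * gaussApprox n ε t by ring, abs_mul, abs_of_pos hg]
  refine mul_le_mul_of_nonneg_right ?_ hg.le
  calc |Real.exp D - 1| ≤ |D| * Real.exp |D| := abs_exp_sub_one_le_mul_exp_abs D
    _ ≤ (10 * gaussError n ε t) * Real.exp 40 := by gcongr; linarith
    _ = 10 * Real.exp 40 * gaussError n ε t := by ring

theorem stmt_2 :
    ∃ ξ : ℝ, 0 < ξ ∧ ∀ n : ℕ, 1 ≤ n → ∀ t : ℤ, ∀ ε : ℝ, ε ∈ Set.Icc (-1 : ℝ) 1 →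
      0 < binPMF n ε t →
      |(t : ℝ)| ≤ (n : ℝ) ^ ((3 : ℝ) / 5) →
      |ε| ≤ (n : ℝ) ^ (-(2 : ℝ) / 5) →
      |binPMF n ε t -
          Real.sqrt (2 / Real.pi) * (1 / Real.sqrt n) *
            Real.exp (-((t : ℝ) - ε * n) ^ 2 / (2 * n))| ≤
        ξ * (ε ^ 2 * |(t : ℝ)| + 1 / n + |(t : ℝ)| ^ 3 / (n : ℝ) ^ 2 + ε ^ 4 * n) *
          (Real.sqrt (2 / Real.pi) * (1 / Real.sqrt n) *
            Real.exp (-((t : ℝ) - ε * n) ^ 2 / (2 * n))) := by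
  have hpi : 0 < Real.sqrt (2 / Real.pi) := by have := Real.pi_pos; positivity
  set c : ℝ := Real.sqrt (2 / Real.pi) * Real.exp (-2) with hc
  have hcpos : 0 < c := by positivity
  refine ⟨10 * Real.exp 40 + (1 / c + 1), by positivity, fun n hn t ε hε hpos ht hεn ↦ ?_⟩
  change |binPMF n ε t - gaussApprox n ε t| ≤
    (10 * Real.exp 40 + (1 / c + 1)) * gaussError n ε t * gaussApprox n ε t
  have hg := gaussApprox_pos hn ε t
  have hE := gaussError_nonneg n ε t
  have hc0 : 0 < 1 / c := by positivity
  rcases hn.eq_or_lt' with h1 | h2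
  · have hb := binPMF_one_le_one hε t
    subst h1
    have hE1 : 1 ≤ gaussError 1 ε t := by
      have h : 0 ≤ ε ^ 2 * |(t : ℝ)| + |(t : ℝ)| ^ 3 + ε ^ 4 := by positivity
      norm_num [gaussError]
      linarith
    have hcg : c ≤ gaussApprox 1 ε t := by
      norm_num at ht
      obtain ⟨ht1, ht2⟩ := abs_le.mp ht
      obtain ⟨he1, he2⟩ := hε
      simp only [gaussApprox, hc, Nat.cast_one, Real.sqrt_one, div_one, mul_one]
      refine mul_le_mul_of_nonneg_left (Real.exp_le_exp.2 ?_) hpi.le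
      have : ((t : ℝ) - ε) ^ 2 ≤ 2 ^ 2 := by
        apply sq_le_sq' <;> linarith
      linarith
    have h1c : 1 ≤ 1 / c * gaussApprox 1 ε t := by
      rw [one_div_mul_eq_div, le_div_iff₀ hcpos]
      linarith
    calc |binPMF 1 ε t - gaussApprox 1 ε t| ≤ (1 / c + 1) * 1 * gaussApprox 1 ε t := by
          rw [abs_le]
          constructor <;> nlinarith
      _ ≤ (10 * Real.exp 40 + (1 / c + 1)) * gaussError 1 ε t * gaussApprox 1 ε t := by
          have h40 : 1 / c + 1 ≤ 10 * Real.exp 40 + (1 / c + 1) := by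
            linarith [Real.exp_pos 40]
          exact mul_le_mul_of_nonneg_right
            (mul_le_mul h40 hE1 zero_le_one (by positivity)) hg.le
  · refine (abs_binPMF_sub_gaussApprox_le h2 hpos ht hεn).trans ?_
    gcongr
    linarith
end

section
/- There exists a function φ : ℝ_{>0} → ℝ_{>0} such that for every c > 0, every n ∈ ℕ with n ≥ 1, every δ with n^{-c} < δ < 1 − n^{-c}, and every ε ∈ [-1,1] satisfying V(n,ε)(0) = δ, it holds that |ε + Φ⁻¹(δ)/√n| ≤ φ(c)·log^{1.5} n / n. -/
noncomputable def stdGaussTail (x : ℝ) : ℝ :=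
  (Real.sqrt (2 * Real.pi))⁻¹ * ∫ t in Set.Ioi x, Real.exp (-t ^ 2 / 2)

noncomputable def stdGaussTailInv : ℝ → ℝ := Function.invFun stdGaussTail

section SignChange

open Set Filter Topology

/-- If the derivative of `D` changes sign at most once, from positive to negative, and `D` is
nonnegative at both ends of an interval, then `D` is nonnegative on the interval. -/
theorem nonneg_of_deriv_sign_change {D h r : ℝ → ℝ} {a b : ℝ} (hc : ContinuousOn D (Icc a b))
    (hd : ∀ x ∈ Ioo a b, HasDerivAt D (h x * r x) x) (hh : ∀ x ∈ Ioo a b, 0 < h x)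
    (hr : AntitoneOn r (Ioo a b)) (ha : 0 ≤ D a) (hb : 0 ≤ D b) {x : ℝ} (hx : x ∈ Icc a b) :
    0 ≤ D x := by
  by_contra! hneg
  have hax : a < x := lt_of_le_of_ne hx.1 (by rintro rfl; linarith)
  have hxb : x < b := lt_of_le_of_ne hx.2 (by rintro rfl; linarith)
  obtain ⟨ξ, hξ, hξ'⟩ := exists_hasDerivAt_eq_slope D (fun x => h x * r x) hax
    (hc.mono (Icc_subset_Icc_right hxb.le)) (fun y hy => hd y ⟨hy.1, hy.2.trans hxb⟩)
  obtain ⟨η, hη, hη'⟩ := exists_hasDerivAt_eq_slope D (fun x => h x * r x) hxb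
    (hc.mono (Icc_subset_Icc_left hax.le)) (fun y hy => hd y ⟨hax.trans hy.1, hy.2⟩)
  have hξI : ξ ∈ Ioo a b := ⟨hξ.1, hξ.2.trans hxb⟩
  have hηI : η ∈ Ioo a b := ⟨hax.trans hη.1, hη.2⟩
  have h1 : h ξ * r ξ < 0 := by
    rw [hξ']; exact div_neg_of_neg_of_pos (by linarith) (by linarith)
  have h2 : 0 < h η * r η := by
    rw [hη']; exact div_pos (by linarith) (by linarith)
  have h3 : r ξ < 0 := neg_of_mul_neg_right h1 (hh ξ hξI).le
  have h4 : 0 < r η := pos_of_mul_pos_right h2 (hh η hηI).le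
  linarith [hr hξI hηI (hξ.2.trans hη.1).le]

/-- The version of `nonneg_of_deriv_sign_change` on a half-line, with limit `0` at infinity. -/
theorem nonneg_of_deriv_sign_change_of_tendsto {D h r : ℝ → ℝ} {a : ℝ}
    (hc : ContinuousOn D (Ici a)) (hd : ∀ x ∈ Ioi a, HasDerivAt D (h x * r x) x)
    (hh : ∀ x ∈ Ioi a, 0 < h x) (hr : AntitoneOn r (Ioi a)) (ha : 0 ≤ D a)
    (hlim : Tendsto D atTop (𝓝 0)) {x : ℝ} (hx : a ≤ x) : 0 ≤ D x := by
  by_contra! hneg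
  have hax : a < x := lt_of_le_of_ne hx (by rintro rfl; linarith)
  obtain ⟨ξ, hξ, hξ'⟩ := exists_hasDerivAt_eq_slope D (fun x => h x * r x) hax
    (hc.mono Icc_subset_Ici_self) (fun y hy => hd y hy.1)
  have h1 : h ξ * r ξ < 0 := by
    rw [hξ']; exact div_neg_of_neg_of_pos (by linarith) (by linarith)
  have h3 : r ξ < 0 := neg_of_mul_neg_right h1 (hh ξ hξ.1).le
  have h5 : ∀ y, x ≤ y → D y ≤ D x := by
    intro y hy
    rcases hy.eq_or_lt with rfl | hxy
    · exact le_rfl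
    obtain ⟨η, hη, hη'⟩ := exists_hasDerivAt_eq_slope D (fun x => h x * r x) hxy
      (hc.mono (Icc_subset_Ici_self.trans (Ici_subset_Ici.2 hx)))
      (fun y hy => hd y (hax.trans hy.1))
    have hηI : η ∈ Ioi a := hax.trans hη.1
    have h4 : r η ≤ 0 := (hr hξ.1 hηI (hξ.2.trans hη.1).le).trans h3.le
    have h6 : h η * r η ≤ 0 := mul_nonpos_of_nonneg_of_nonpos (hh η hηI).le h4
    rw [hη', div_le_iff₀ (by linarith)] at h6
    linarith
  have := le_of_tendsto hlim ((eventually_ge_atTop x).mono h5)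
  linarith

end SignChange

section Gaussian

open Set Filter Topology MeasureTheory

theorem integrable_exp_neg_sq_div_two : Integrable (fun t : ℝ => Real.exp (-t ^ 2 / 2)) := by
  refine (integrable_exp_neg_mul_sq (b := 1 / 2) (by norm_num)).congr (ae_of_all _ fun t => ?_)
  simp only; congr 1; ring

theorem stdGaussTail_hasDerivAt (x : ℝ) :
    HasDerivAt stdGaussTail (-((Real.sqrt (2 * Real.pi))⁻¹ * Real.exp (-x ^ 2 / 2))) x := by
  have hcont : Continuous (fun t : ℝ => Real.exp (-t ^ 2 / 2)) := by fun_prop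
  have h1 : HasDerivAt (fun u => ∫ t in (0 : ℝ)..u, Real.exp (-t ^ 2 / 2))
      (Real.exp (-x ^ 2 / 2)) x :=
    intervalIntegral.integral_hasDerivAt_right (hcont.intervalIntegrable _ _)
      (hcont.stronglyMeasurableAtFilter _ _) hcont.continuousAt
  have h2 : stdGaussTail = fun u => (Real.sqrt (2 * Real.pi))⁻¹ *
      ((∫ t in Ioi (0 : ℝ), Real.exp (-t ^ 2 / 2)) - ∫ t in (0 : ℝ)..u, Real.exp (-t ^ 2 / 2)) := by
    funext u
    rw [stdGaussTail, ← intervalIntegral.integral_Ioi_sub_Ioi'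
      integrable_exp_neg_sq_div_two.integrableOn integrable_exp_neg_sq_div_two.integrableOn]
    ring
  rw [h2]
  convert! (h1.const_sub _).const_mul _ using 1
  ring

theorem stdGaussTail_continuous : Continuous stdGaussTail :=
  continuous_iff_continuousAt.2 fun x => (stdGaussTail_hasDerivAt x).continuousAt

theorem stdGaussTail_strictAnti : StrictAnti stdGaussTail :=
  strictAnti_of_hasDerivAt_neg stdGaussTail_hasDerivAt fun x => by
    have := Real.pi_pos
    have : 0 < (Real.sqrt (2 * Real.pi))⁻¹ * Real.exp (-x ^ 2 / 2) := by positivity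
    linarith

theorem stdGaussTail_zero : stdGaussTail 0 = 1 / 2 := by
  have h := integral_gaussian_Ioi (1 / 2)
  have h2 : (∫ t in Ioi (0 : ℝ), Real.exp (-t ^ 2 / 2)) = Real.sqrt (Real.pi / (1 / 2)) / 2 := by
    rw [← h]; congr 1; funext t; congr 1; ring
  have : 0 < Real.sqrt (2 * Real.pi) := by have := Real.pi_pos; positivity
  rw [stdGaussTail, h2, show Real.pi / (1 / 2) = 2 * Real.pi by ring]
  field_simp

theorem stdGaussTail_neg (x : ℝ) : stdGaussTail (-x) = 1 - stdGaussTail x := by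
  have hd : ∀ y, HasDerivAt (fun y => stdGaussTail (-y) + stdGaussTail y) 0 y := by
    intro y
    have h1 := (stdGaussTail_hasDerivAt (-y)).comp y (hasDerivAt_neg y)
    convert! h1.add (stdGaussTail_hasDerivAt y) using 1
    rw [neg_sq]; ring
  have := is_const_of_deriv_eq_zero (fun y => (hd y).differentiableAt) (fun y => (hd y).deriv) x 0
  simp only [neg_zero, stdGaussTail_zero] at this
  linarith

theorem stdGaussTail_tendsto : Tendsto stdGaussTail atTop (𝓝 0) := by
  have := (tendsto_integral_Ioi_zero (μ := volume) (f := fun t : ℝ => Real.exp (-t ^ 2 / 2))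
    (tendsto_id (α := ℝ) (x := atTop))).const_mul (Real.sqrt (2 * Real.pi))⁻¹
  rw [mul_zero] at this
  exact this

theorem stdGaussTail_stdGaussTailInv {δ : ℝ} (h0 : 0 < δ) (h1 : δ < 1) :
    stdGaussTail (stdGaussTailInv δ) = δ := by
  refine Function.invFun_eq ?_
  obtain ⟨x, hx⟩ := (stdGaussTail_tendsto.eventually (gt_mem_nhds h0)).exists
  obtain ⟨y, hy⟩ := (stdGaussTail_tendsto.eventually (gt_mem_nhds (sub_pos.2 h1))).exists
  refine mem_range_of_exists_le_of_exists_ge stdGaussTail_continuous ⟨x, hx.le⟩ ⟨-y, ?_⟩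
  rw [stdGaussTail_neg]; linarith

theorem tendsto_exp_neg_sq_div_two :
    Tendsto (fun x : ℝ => Real.exp (-x ^ 2 / 2)) atTop (𝓝 0) := by
  refine Real.tendsto_exp_atBot.comp ?_
  have : Tendsto (fun x : ℝ => x ^ 2 / 2) atTop atTop :=
    (tendsto_pow_atTop two_ne_zero).atTop_div_const two_pos
  simpa only [neg_div, Function.comp_def] using tendsto_neg_atTop_atBot.comp this

theorem stdGaussTail_le_exp {x : ℝ} (hx : 0 ≤ x) : stdGaussTail x ≤ Real.exp (-x ^ 2 / 2) := by
  have hd : ∀ y : ℝ, HasDerivAt (fun y => Real.exp (-y ^ 2 / 2) - stdGaussTail y)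
      (Real.exp (-y ^ 2 / 2) * ((Real.sqrt (2 * Real.pi))⁻¹ - y)) y := by
    intro y
    have h1 : HasDerivAt (fun y : ℝ => -y ^ 2 / 2) (-y) y := by
      convert! ((hasDerivAt_pow 2 y).neg.div_const 2) using 1
      simp; ring
    convert! h1.exp.sub (stdGaussTail_hasDerivAt y) using 1
    ring
  have := nonneg_of_deriv_sign_change_of_tendsto (a := 0)
    (fun y _ => (hd y).continuousAt.continuousWithinAt) (fun y _ => hd y)
    (fun y _ => Real.exp_pos _) (fun y _ z _ hyz => sub_le_sub_left hyz _)
    (by rw [stdGaussTail_zero]; norm_num)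
    (by simpa using tendsto_exp_neg_sq_div_two.sub stdGaussTail_tendsto) hx
  linarith

end Gaussian

section BinomialTail

theorem binTail_zero_eq_sum_bernstein (n : ℕ) (ε : ℝ) :
    binTail n ε 0 =
      ∑ j ∈ Finset.Ico ((n + 1) / 2) (n + 1), (bernsteinPolynomial ℝ n j).eval ((1 + ε) / 2) := by
  rw [binTail]
  symm
  refine Finset.sum_of_injOn (fun j : ℕ => 2 * (j : ℤ) - n) ?_ ?_ ?_ ?_
  · intro a _ b _ h
    simp only at h
    omega
  · intro j hj
    simp only [Finset.coe_Ico, Set.mem_Ico, Finset.coe_Icc, Set.mem_Icc] at hj ⊢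
    omega
  · intro t ht hnt
    rw [binPMF, if_neg]
    rintro ⟨h1, h2, h3⟩
    apply hnt
    rw [Finset.mem_Icc] at ht
    refine ⟨(((n : ℤ) + t) / 2).toNat, ?_, ?_⟩
    · simp only [Finset.coe_Ico, Set.mem_Ico]
      omega
    · simp only
      omega
  · intro j hj
    rw [Finset.mem_Ico] at hj
    have h1 : (((n : ℤ) + (2 * (j : ℤ) - n)) / 2).toNat = j := by omega
    have h2 : (((n : ℤ) - (2 * (j : ℤ) - n)) / 2).toNat = n - j := by omega
    rw [binPMF, if_pos (by omega), h1, h2]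
    simp only [bernsteinPolynomial, Polynomial.eval_mul, Polynomial.eval_natCast,
      Polynomial.eval_pow, Polynomial.eval_X, Polynomial.eval_sub, Polynomial.eval_one]
    congr 2
    ring

theorem derivative_sum_bernstein_Ico {k n : ℕ} (hk : k ≤ n) (hn : 1 ≤ n) :
    Polynomial.derivative (∑ j ∈ Finset.Ico (k + 1) (n + 1), bernsteinPolynomial ℝ n j) =
      n * bernsteinPolynomial ℝ (n - 1) k := by
  rw [Polynomial.derivative_sum, ← Finset.sum_Ico_add']
  simp only [bernsteinPolynomial.derivative_succ]
  rw [← Finset.mul_sum]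
  congr 1
  rw [← neg_inj, ← Finset.sum_neg_distrib]
  simp only [neg_sub]
  rw [Finset.sum_Ico_sub _ hk, bernsteinPolynomial.eq_zero_of_lt ℝ (by omega : n - 1 < n), zero_sub]

theorem binTail_hasDerivAt {n : ℕ} (hn : 1 ≤ n) (x : ℝ) :
    HasDerivAt (fun ε => binTail n ε 0)
      (n / 2 * (bernsteinPolynomial ℝ (n - 1) ((n - 1) / 2)).eval ((1 + x) / 2)) x := by
  have h0 : (n + 1) / 2 = (n - 1) / 2 + 1 := by omega
  simp only [binTail_zero_eq_sum_bernstein, h0, ← Polynomial.eval_finsetSum]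
  have h1 : HasDerivAt (fun ε : ℝ => (1 + ε) / 2) (1 / 2) x :=
    ((hasDerivAt_id x).const_add 1).div_const 2
  convert! ((Polynomial.hasDerivAt _ _).comp x h1) using 1
  rw [derivative_sum_bernstein_Ico (by omega) hn]
  simp
  ring

theorem binTail_odd_hasDerivAt (m : ℕ) : ∃ K : ℝ, 0 < K ∧ ∀ x,
    HasDerivAt (fun ε => binTail (2 * m + 1) ε 0) (K * (1 - x ^ 2) ^ m) x := by
  refine ⟨((2 * m + 1 : ℕ) : ℝ) / 2 * (2 * m).choose m * (1 / 4) ^ m, ?_, fun x => ?_⟩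
  · have : 0 < (2 * m).choose m := Nat.choose_pos (by omega)
    positivity
  convert! binTail_hasDerivAt (by omega : 1 ≤ 2 * m + 1) x using 1
  rw [show (2 * m + 1 - 1) / 2 = m by omega, show 2 * m + 1 - 1 = 2 * m by omega]
  simp only [bernsteinPolynomial, Polynomial.eval_mul, Polynomial.eval_natCast,
      Polynomial.eval_pow, Polynomial.eval_X, Polynomial.eval_sub, Polynomial.eval_one]
  rw [show 2 * m - m = m by omega, show 1 - x ^ 2 = 4 * (((1 + x) / 2) * (1 - (1 + x) / 2)) by ring]
  simp only [mul_pow, one_div, inv_pow]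
  field_simp

theorem binTail_even_hasDerivAt (m : ℕ) : ∃ K : ℝ, 0 < K ∧ ∀ x,
    HasDerivAt (fun ε => binTail (2 * m + 2) ε 0) (K * (1 - x ^ 2) ^ m * (1 - x)) x := by
  refine ⟨((2 * m + 2 : ℕ) : ℝ) / 2 * (2 * m + 1).choose m * (1 / 4) ^ m * (1 / 2), ?_, fun x => ?_⟩
  · have : 0 < (2 * m + 1).choose m := Nat.choose_pos (by omega)
    positivity
  convert! binTail_hasDerivAt (by omega : 1 ≤ 2 * m + 2) x using 1
  rw [show (2 * m + 2 - 1) / 2 = m by omega, show 2 * m + 2 - 1 = 2 * m + 1 by omega]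
  simp only [bernsteinPolynomial, Polynomial.eval_mul, Polynomial.eval_natCast,
      Polynomial.eval_pow, Polynomial.eval_X, Polynomial.eval_sub, Polynomial.eval_one]
  rw [show 2 * m + 1 - m = m + 1 by omega,
    show 1 - x ^ 2 = 4 * (((1 + x) / 2) * (1 - (1 + x) / 2)) by ring, pow_succ (1 - (1 + x) / 2)]
  simp only [mul_pow, one_div, inv_pow]
  field_simp
  ring

theorem binTail_continuous {n : ℕ} (hn : 1 ≤ n) : Continuous (fun ε => binTail n ε 0) :=
  continuous_iff_continuousAt.2 fun x => (binTail_hasDerivAt hn x).continuousAt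

theorem binTail_neg_one {n : ℕ} (hn : 1 ≤ n) : binTail n (-1) 0 = 0 := by
  rw [binTail_zero_eq_sum_bernstein]
  refine Finset.sum_eq_zero fun j hj => ?_
  rw [Finset.mem_Ico] at hj
  norm_num [bernsteinPolynomial.eval_at_0]
  omega

theorem binTail_one {n : ℕ} : binTail n 1 0 = 1 := by
  rw [binTail_zero_eq_sum_bernstein]
  norm_num [bernsteinPolynomial.eval_at_1]
  omega

theorem binTail_strictMonoOn {n : ℕ} (hn : 1 ≤ n) :
    StrictMonoOn (fun ε => binTail n ε 0) (Set.Icc (-1) 1) := by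
  refine strictMonoOn_of_deriv_pos (convex_Icc _ _) (binTail_continuous hn).continuousOn ?_
  intro x hx
  rw [interior_Icc] at hx
  rw [(binTail_hasDerivAt hn x).deriv]
  simp only [bernsteinPolynomial, Polynomial.eval_mul, Polynomial.eval_natCast,
      Polynomial.eval_pow, Polynomial.eval_X, Polynomial.eval_sub, Polynomial.eval_one]
  have h1 : 0 < (1 + x) / 2 := by linarith [hx.1]
  have h2 : 0 < 1 - (1 + x) / 2 := by linarith [hx.2]
  have h3 : 0 < (n - 1).choose ((n - 1) / 2) := Nat.choose_pos (by omega)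
  positivity

theorem binTail_odd_neg (m : ℕ) (x : ℝ) :
    binTail (2 * m + 1) (-x) 0 = 1 - binTail (2 * m + 1) x 0 := by
  obtain ⟨K, -, hK⟩ := binTail_odd_hasDerivAt m
  have hd : ∀ y, HasDerivAt
      (fun y => binTail (2 * m + 1) (-y) 0 + binTail (2 * m + 1) y 0) 0 y := by
    intro y
    have h1 := (hK (-y)).comp y (hasDerivAt_neg y)
    convert! h1.add (hK y) using 1
    rw [neg_sq]; ring
  have := is_const_of_deriv_eq_zero (fun y => (hd y).differentiableAt) (fun y => (hd y).deriv) x 1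
  simp only [binTail_neg_one (show 1 ≤ 2 * m + 1 by omega), binTail_one] at this
  linarith

theorem binTail_odd_le_even (m : ℕ) {x : ℝ} (hx : x ∈ Set.Icc (-1 : ℝ) 1) :
    binTail (2 * m + 1) x 0 ≤ binTail (2 * m + 2) x 0 := by
  obtain ⟨K, hK0, hK⟩ := binTail_odd_hasDerivAt m
  obtain ⟨L, hL0, hL⟩ := binTail_even_hasDerivAt m
  have hd : ∀ y, HasDerivAt (fun y => binTail (2 * m + 2) y 0 - binTail (2 * m + 1) y 0)
      ((1 - y ^ 2) ^ m * (L * (1 - y) - K)) y := fun y => by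
    convert! (hL y).sub (hK y) using 1; ring
  have := nonneg_of_deriv_sign_change (fun y _ => (hd y).continuousAt.continuousWithinAt)
    (fun y _ => hd y) (fun y hy => pow_pos (by nlinarith [hy.1, hy.2]) _)
    (fun y _ z _ hyz => by simp only; gcongr)
    (by simp [binTail_neg_one]) (by simp [binTail_one]) hx
  linarith

/-- The likelihood ratio of the two densities compared in `binTail_even_le_odd_shift`. -/
theorem antitoneOn_shift_ratio (m : ℕ) {s : ℝ} (hs : s = 2 / (m + 1)) :
    AntitoneOn (fun x : ℝ => (1 + s / (1 + x)) ^ m * ((1 - s / (1 - x)) ^ m * (1 / (1 - x))))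
      (Set.Ioo (-1) (1 - s)) := by
  have hs0 : 0 < s := by rw [hs]; positivity
  have hsm : s * (m + 1) = 2 := by rw [hs]; field_simp
  intro x hx y hy hxy
  have hx1 : 0 < 1 + x := by linarith [hx.1]
  have hx2 : 0 < 1 - x := by linarith [hx.2]
  have hy1 : 0 < 1 + y := by linarith [hy.1]
  have hy2 : 0 < 1 - y := by linarith [hy.2]
  simp only
  have hys : 0 < 1 - s / (1 - y) := by
    rw [sub_pos, div_lt_one hy2]; linarith [hy.2]
  have hxs : 0 < 1 - s / (1 - x) := by
    rw [sub_pos, div_lt_one hx2]; linarith [hx.2]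
  refine mul_le_mul (by gcongr) ?_ (by positivity) (by positivity)
  have hb := one_add_mul_le_pow (a := (1 - s / (1 - x)) / (1 - s / (1 - y)) - 1)
    (by have := div_pos hxs hys; linarith) m
  rw [add_sub_cancel, div_pow] at hb
  have hq : (1 - x) / (1 - y) ≤ 1 + m * ((1 - s / (1 - x)) / (1 - s / (1 - y)) - 1) := by
    have h1 : (1 - s / (1 - x)) / (1 - s / (1 - y)) - 1
        = s * (y - x) / ((1 - x) * (1 - y - s)) := by
      have : 0 < 1 - y - s := by linarith [hy.2]
      have h3 : 1 - s / (1 - y) = (1 - y - s) / (1 - y) := by field_simp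
      rw [h3]
      field_simp
      ring
    have h2 : (1 - x) / (1 - y) = 1 + (y - x) / (1 - y) := by field_simp; ring
    have hp : 0 < 1 - y - s := by linarith [hy.2]
    rw [h1, h2, add_le_add_iff_left, ← mul_div_assoc, div_le_div_iff₀ hy2 (by positivity)]
    have h4 : (1 - x) * (1 - y - s) ≤ m * s * (1 - y) := by
      nlinarith [hx.1, mul_pos hx2 hs0, mul_pos hy2 hs0]
    nlinarith [mul_le_mul_of_nonneg_left h4 (sub_nonneg.2 hxy)]
  have := hq.trans hb
  rw [div_le_div_iff₀ hy2 (pow_pos hys m)] at this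
  rw [mul_one_div, mul_one_div, div_le_div_iff₀ hy2 hx2]
  linarith

theorem binTail_even_le_odd_shift (m : ℕ) {s x : ℝ} (hs : s = 2 / (m + 1))
    (hx : x ∈ Set.Icc (-1 : ℝ) (1 - s)) :
    binTail (2 * m + 2) x 0 ≤ binTail (2 * m + 1) (x + s) 0 := by
  have hs0 : 0 < s := by rw [hs]; positivity
  obtain ⟨K, hK0, hK⟩ := binTail_odd_hasDerivAt m
  obtain ⟨L, hL0, hL⟩ := binTail_even_hasDerivAt m
  have hd : ∀ y, HasDerivAt (fun y => binTail (2 * m + 1) (y + s) 0 - binTail (2 * m + 2) y 0)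
      (K * (1 - (y + s) ^ 2) ^ m - L * (1 - y ^ 2) ^ m * (1 - y)) y := fun y =>
    ((hK (y + s)).comp_add_const y s).sub (hL y)
  have hI : ∀ y ∈ Set.Ioo (-1 : ℝ) (1 - s), 0 < 1 + y ∧ 0 < 1 - y := fun y hy =>
    ⟨by linarith [hy.1], by linarith [hy.2]⟩
  have h1 : s - 1 ∈ Set.Icc (-1 : ℝ) 1 := ⟨by linarith, by linarith [hx.1, hx.2]⟩
  have h2 : 1 - s ∈ Set.Icc (-1 : ℝ) 1 := ⟨by linarith [h1.2], by linarith⟩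
  have := nonneg_of_deriv_sign_change (a := -1) (b := 1 - s)
    (h := fun y => (1 - y ^ 2) ^ m * (1 - y))
    (r := fun y => K * ((1 + s / (1 + y)) ^ m * ((1 - s / (1 - y)) ^ m * (1 / (1 - y)))) - L)
    (fun y _ => (hd y).continuousAt.continuousWithinAt)
    (fun y hy => by
      obtain ⟨hy1, hy2⟩ := hI y hy
      convert! hd y using 1
      rw [show 1 - (y + s) ^ 2 = ((1 + s / (1 + y)) * (1 - s / (1 - y))) * (1 - y ^ 2) by
        field_simp; ring]
      simp only [mul_pow]
      field_simp)
    (fun y hy => by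
      obtain ⟨hy1, hy2⟩ := hI y hy
      exact mul_pos (pow_pos (by nlinarith) _) hy2)
    (fun y hy z hz hyz => by
      have := mul_le_mul_of_nonneg_left (antitoneOn_shift_ratio m hs hy hz hyz) hK0.le
      simp only at this ⊢
      linarith)
    (by
      have := (binTail_strictMonoOn (n := 2 * m + 1) (by omega)).monotoneOn
        (by simp) h1 (by linarith : (-1 : ℝ) ≤ s - 1)
      simp only [binTail_neg_one (show 1 ≤ 2 * m + 1 by omega)] at this
      rw [binTail_neg_one (by omega), neg_add_eq_sub]
      linarith)
    (by
      have := (binTail_strictMonoOn (n := 2 * m + 2) (by omega)).monotoneOn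
        h2 (by simp) (by linarith : 1 - s ≤ (1 : ℝ))
      simp only [binTail_one] at this
      rw [sub_add_cancel, binTail_one]
      linarith) hx
  linarith

end BinomialTail

section Comparison

open Set Filter Topology

theorem mul_exp_sub_one_le (s : ℝ) {a b : ℝ} (ha : 0 ≤ a) (hab : a ≤ b) :
    b * (Real.exp (s * a) - 1) ≤ a * (Real.exp (s * b) - 1) := by
  rcases (ha.trans hab).eq_or_lt with hb | hb
  · have : a = 0 := by linarith
    simp [this, ← hb]
  have h := convexOn_exp.2 (mem_univ (s * b)) (mem_univ 0) (div_nonneg ha hb.le)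
    (sub_nonneg.2 ((div_le_one hb).2 hab)) (add_sub_cancel _ _)
  simp only [smul_eq_mul, mul_zero, add_zero, Real.exp_zero, mul_one] at h
  rw [show a / b * (s * b) = s * a by field_simp] at h
  calc b * (Real.exp (s * a) - 1)
      ≤ b * (a / b * Real.exp (s * b) + (1 - a / b) - 1) := by gcongr
    _ = a * (Real.exp (s * b) - 1) := by field_simp; ring

theorem exp_neg_sq_lt_one {u : ℝ} (hu : 0 < u) : Real.exp (-u ^ 2) < 1 :=
  Real.exp_zero ▸ Real.exp_lt_exp.2 (by have := pow_pos hu 2; linarith)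

theorem monotoneOn_div_sqrt_one_sub_exp :
    MonotoneOn (fun u : ℝ => u / √(1 - Real.exp (-u ^ 2))) (Ioi 0) := by
  intro u hu v hv huv
  have hu0 : 0 < u := hu
  have hv0 : 0 < v := hv
  have hA := sub_pos.2 (exp_neg_sq_lt_one hu0)
  have hB := sub_pos.2 (exp_neg_sq_lt_one hv0)
  have h := mul_exp_sub_one_le (-1) (sq_nonneg u) (pow_le_pow_left₀ hu0.le huv 2)
  rw [neg_one_mul, neg_one_mul] at h
  simp only
  rw [div_le_div_iff₀ (Real.sqrt_pos.2 hA) (Real.sqrt_pos.2 hB)]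
  refine le_of_sq_le_sq ?_ (by positivity)
  rw [mul_pow, mul_pow, Real.sq_sqrt hA.le, Real.sq_sqrt hB.le]
  linarith

theorem antitoneOn_div_sqrt_one_sub_exp_mul_exp :
    AntitoneOn (fun u : ℝ => u / √(1 - Real.exp (-u ^ 2)) * Real.exp (-u ^ 2 / 2)) (Ioi 0) := by
  intro u hu v hv huv
  have hu0 : 0 < u := hu
  have hv0 : 0 < v := hv
  have hA := sub_pos.2 (exp_neg_sq_lt_one hu0)
  have hB := sub_pos.2 (exp_neg_sq_lt_one hv0)
  have h := mul_exp_sub_one_le 1 (sq_nonneg u) (pow_le_pow_left₀ hu0.le huv 2)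
  rw [one_mul, one_mul] at h
  have hsq : ∀ w : ℝ, Real.exp (-w ^ 2 / 2) ^ 2 = Real.exp (-w ^ 2) := fun w => by
    rw [← Real.exp_nat_mul]; congr 1; push_cast; ring
  simp only
  rw [div_mul_eq_mul_div, div_mul_eq_mul_div,
    div_le_div_iff₀ (Real.sqrt_pos.2 hB) (Real.sqrt_pos.2 hA)]
  refine le_of_sq_le_sq ?_ (by positivity)
  simp only [mul_pow, Real.sq_sqrt hA.le, Real.sq_sqrt hB.le, hsq]
  have e : ∀ w : ℝ, Real.exp (w ^ 2) * Real.exp (-w ^ 2) = 1 := fun w => by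
    rw [← Real.exp_add, add_neg_cancel, Real.exp_zero]
  have hp : 0 ≤ Real.exp (-u ^ 2) * Real.exp (-v ^ 2) := by positivity
  calc v ^ 2 * Real.exp (-v ^ 2) * (1 - Real.exp (-u ^ 2))
      = v ^ 2 * (Real.exp (u ^ 2) - 1) * (Real.exp (-u ^ 2) * Real.exp (-v ^ 2)) := by
        linear_combination (-(v ^ 2) * Real.exp (-v ^ 2)) * e u
    _ ≤ u ^ 2 * (Real.exp (v ^ 2) - 1) * (Real.exp (-u ^ 2) * Real.exp (-v ^ 2)) := by gcongr
    _ = u ^ 2 * Real.exp (-u ^ 2) * (1 - Real.exp (-v ^ 2)) := by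
        linear_combination (u ^ 2 * Real.exp (-u ^ 2)) * e v

theorem hasDerivAt_sqrt_one_sub_exp {u : ℝ} (hu : 0 < u) :
    HasDerivAt (fun u : ℝ => √(1 - Real.exp (-u ^ 2)))
      (u * Real.exp (-u ^ 2) / √(1 - Real.exp (-u ^ 2))) u := by
  have hA := sub_pos.2 (exp_neg_sq_lt_one hu)
  have h1 : HasDerivAt (fun u : ℝ => -u ^ 2) (-(2 * u)) u := by
    convert! (hasDerivAt_pow 2 u).neg using 1
    simp
  convert! (h1.exp.const_sub 1).sqrt hA.ne' using 1
  field_simp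

theorem tendsto_sqrt_one_sub_exp :
    Tendsto (fun u : ℝ => √(1 - Real.exp (-u ^ 2))) atTop (𝓝 1) := by
  have h : Tendsto (fun u : ℝ => Real.exp (-u ^ 2)) atTop (𝓝 0) :=
    Real.tendsto_exp_atBot.comp
      (tendsto_neg_atTop_atBot.comp (tendsto_pow_atTop (α := ℝ) two_ne_zero))
  simpa using (h.const_sub 1).sqrt

variable (m : ℕ)

theorem exists_hasDerivAt_binTail_odd_comp : ∃ K : ℝ, 0 < K ∧ ∀ u : ℝ, 0 < u →
    HasDerivAt (fun u => binTail (2 * m + 1) (√(1 - Real.exp (-u ^ 2))) 0)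
      (K * (u / √(1 - Real.exp (-u ^ 2))) * Real.exp (-((m + 1) * u ^ 2))) u := by
  obtain ⟨K, hK0, hK⟩ := binTail_odd_hasDerivAt m
  refine ⟨K, hK0, fun u hu => ?_⟩
  have hA := sub_pos.2 (exp_neg_sq_lt_one hu)
  convert! (hK _).comp u (hasDerivAt_sqrt_one_sub_exp hu) using 1
  rw [Real.sq_sqrt hA.le, sub_sub_cancel, ← Real.exp_nat_mul,
    show -((m + 1) * u ^ 2) = m * -u ^ 2 + -u ^ 2 by ring, Real.exp_add]
  ring

theorem hasDerivAt_stdGaussTail_sqrt_mul {a : ℝ} (ha : 0 ≤ a) (u : ℝ) :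
    HasDerivAt (fun u => stdGaussTail (√a * u))
      (-(√a * (√(2 * Real.pi))⁻¹ * Real.exp (-(a * u ^ 2 / 2)))) u := by
  convert! (stdGaussTail_hasDerivAt (√a * u)).comp u ((hasDerivAt_id u).const_mul √a) using 1
  rw [mul_pow, Real.sq_sqrt ha, neg_div]
  ring

theorem tendsto_stdGaussTail_sqrt_mul {a : ℝ} (ha : 0 < a) :
    Tendsto (fun u => stdGaussTail (√a * u)) atTop (𝓝 0) :=
  stdGaussTail_tendsto.comp (tendsto_id.const_mul_atTop (Real.sqrt_pos.2 ha))

theorem tendsto_binTail_odd_comp :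
    Tendsto (fun u => binTail (2 * m + 1) (√(1 - Real.exp (-u ^ 2))) 0) atTop (𝓝 1) := by
  have := ((binTail_continuous (n := 2 * m + 1) (by omega)).tendsto 1).comp tendsto_sqrt_one_sub_exp
  rw [binTail_one] at this
  exact this

theorem continuous_binTail_odd_comp :
    Continuous (fun u => binTail (2 * m + 1) (√(1 - Real.exp (-u ^ 2))) 0) :=
  (binTail_continuous (n := 2 * m + 1) (by omega)).comp (by fun_prop)

theorem binTail_odd_zero : binTail (2 * m + 1) 0 0 = 1 / 2 := by
  have := binTail_odd_neg m 0
  rw [neg_zero] at this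
  linarith

theorem one_sub_binTail_odd_le_stdGaussTail {u : ℝ} (hu : 0 ≤ u) :
    1 - binTail (2 * m + 1) (√(1 - Real.exp (-u ^ 2))) 0 ≤ stdGaussTail (√(2 * m + 1) * u) := by
  obtain ⟨K, hK0, hK⟩ := exists_hasDerivAt_binTail_odd_comp m
  have ha : (0 : ℝ) < 2 * m + 1 := by positivity
  have hc := continuous_binTail_odd_comp m
  have := nonneg_of_deriv_sign_change_of_tendsto (a := 0)
    (D := fun u => stdGaussTail (√(2 * m + 1) * u) -
      (1 - binTail (2 * m + 1) (√(1 - Real.exp (-u ^ 2))) 0))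
    (h := fun u => Real.exp (-((2 * m + 1) * u ^ 2 / 2)))
    (r := fun u => K * (u / √(1 - Real.exp (-u ^ 2)) * Real.exp (-u ^ 2 / 2)) -
      √(2 * m + 1) * (√(2 * Real.pi))⁻¹)
    ((stdGaussTail_continuous.comp (continuous_const.mul continuous_id)).sub
      (continuous_const.sub hc)).continuousOn
    (fun v hv => by
      convert! (hasDerivAt_stdGaussTail_sqrt_mul ha.le v).sub ((hK v hv).const_sub 1) using 1
      rw [show -((m + 1) * v ^ 2) = -((2 * m + 1) * v ^ 2 / 2) + -v ^ 2 / 2 by ring, Real.exp_add]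
      ring)
    (fun v _ => Real.exp_pos _)
    (fun v hv w hw hvw => by
      have := mul_le_mul_of_nonneg_left (antitoneOn_div_sqrt_one_sub_exp_mul_exp hv hw hvw) hK0.le
      simp only at this ⊢
      linarith)
    (by simp [stdGaussTail_zero, binTail_odd_zero]; norm_num)
    (by simpa using (tendsto_stdGaussTail_sqrt_mul ha).sub
          ((tendsto_binTail_odd_comp m).const_sub 1)) hu
  linarith

theorem stdGaussTail_le_one_sub_binTail_odd {u : ℝ} (hu : 0 ≤ u) :
    stdGaussTail (√(2 * m + 2) * u) ≤ 1 - binTail (2 * m + 1) (√(1 - Real.exp (-u ^ 2))) 0 := by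
  obtain ⟨K, hK0, hK⟩ := exists_hasDerivAt_binTail_odd_comp m
  have ha : (0 : ℝ) < 2 * m + 2 := by positivity
  have hc := continuous_binTail_odd_comp m
  have := nonneg_of_deriv_sign_change_of_tendsto (a := 0)
    (D := fun u => 1 - binTail (2 * m + 1) (√(1 - Real.exp (-u ^ 2))) 0 -
      stdGaussTail (√(2 * m + 2) * u))
    (h := fun u => Real.exp (-((m + 1) * u ^ 2)))
    (r := fun u => √(2 * m + 2) * (√(2 * Real.pi))⁻¹ - K * (u / √(1 - Real.exp (-u ^ 2))))
    ((continuous_const.sub hc).sub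
      (stdGaussTail_continuous.comp (continuous_const.mul continuous_id))).continuousOn
    (fun v hv => by
      convert! ((hK v hv).const_sub 1).sub (hasDerivAt_stdGaussTail_sqrt_mul ha.le v) using 1
      rw [show -((2 * m + 2) * v ^ 2 / 2) = -((m + 1) * v ^ 2) by ring]
      ring)
    (fun v _ => Real.exp_pos _)
    (fun v hv w hw hvw => by
      have := mul_le_mul_of_nonneg_left (monotoneOn_div_sqrt_one_sub_exp hv hw hvw) hK0.le
      simp only at this ⊢
      linarith)
    (by simp [stdGaussTail_zero, binTail_odd_zero]; norm_num)
    (by simpa using ((tendsto_binTail_odd_comp m).const_sub 1).sub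
          (tendsto_stdGaussTail_sqrt_mul ha)) hu
  linarith

end Comparison

section Quantile

theorem abs_sqrt_one_sub_exp_sub_le {u : ℝ} (hu : 0 ≤ u) :
    |√(1 - Real.exp (-u ^ 2)) - u| ≤ u ^ 3 / 2 := by
  rcases hu.eq_or_lt with rfl | hu
  · simp
  set ε := √(1 - Real.exp (-u ^ 2)) with hε
  have hε0 : 0 ≤ ε := Real.sqrt_nonneg _
  have hsq : ε ^ 2 = 1 - Real.exp (-u ^ 2) := Real.sq_sqrt (sub_pos.2 (exp_neg_sq_lt_one hu)).le
  have h1 : ε ^ 2 ≤ u ^ 2 := by linarith [Real.add_one_le_exp (-u ^ 2)]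
  have h2 : ε ≤ u := le_of_sq_le_sq h1 hu.le
  have h3 : u ^ 2 - u ^ 4 / 2 ≤ ε ^ 2 := by
    have hq := Real.quadratic_le_exp_of_nonneg (sq_nonneg u)
    have he : Real.exp (u ^ 2) * Real.exp (-u ^ 2) = 1 := by
      rw [← Real.exp_add, add_neg_cancel, Real.exp_zero]
    have h5 : (1 + u ^ 2 + (u ^ 2) ^ 2 / 2) * Real.exp (-u ^ 2) ≤ 1 :=
      (mul_le_mul_of_nonneg_right hq (Real.exp_pos _).le).trans he.le
    have h6 : 1 ≤ (1 + u ^ 2 + (u ^ 2) ^ 2 / 2) * (1 - u ^ 2 + u ^ 4 / 2) := by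
      nlinarith [sq_nonneg (u ^ 4)]
    have := le_of_mul_le_mul_left (h5.trans h6) (by positivity)
    linarith
  rw [abs_sub_comm, abs_of_nonneg (sub_nonneg.2 h2)]
  have h4 : (u - ε) * u ≤ u ^ 3 / 2 * u := by
    nlinarith [mul_nonneg (sub_nonneg.2 h2) hε0]
  exact le_of_mul_le_mul_right h4 hu

theorem abs_div_sqrt_sub_le {N u y : ℝ} (hN : 0 < N) (hu : 0 ≤ u) (hy : 0 ≤ y)
    (h1 : (N - 1) * u ^ 2 ≤ y ^ 2) (h2 : y ^ 2 ≤ (N + 1) * u ^ 2) :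
    |y / √N - u| ≤ u / N := by
  rcases hu.eq_or_lt with rfl | hu
  · have : y = 0 := by nlinarith
    simp [this]
  have ht0 : 0 ≤ y / √N := by positivity
  have ht : (y / √N) ^ 2 = y ^ 2 / N := by rw [div_pow, Real.sq_sqrt hN.le]
  have habs : |y / √N - u| * (y / √N + u) = |y ^ 2 / N - u ^ 2| := by
    rw [← ht, sq_sub_sq, mul_comm, abs_mul, abs_of_pos (by positivity : 0 < y / √N + u)]
  have h3 : |y ^ 2 / N - u ^ 2| ≤ u ^ 2 / N := by
    have e : y ^ 2 / N - u ^ 2 = (y ^ 2 - N * u ^ 2) / N := by field_simp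
    rw [e, abs_div, abs_of_pos hN]
    gcongr
    rw [abs_le]
    constructor <;> linarith
  have h4 : |y / √N - u| * u ≤ u / N * u := by
    have := mul_nonneg (abs_nonneg (y / √N - u)) ht0
    calc |y / √N - u| * u ≤ u ^ 2 / N := by linarith
      _ = u / N * u := by ring
  exact le_of_mul_le_mul_right h4 hu

theorem abs_sub_div_sqrt_le_of_nonneg {m n : ℕ} (hn : n = 2 * m + 1 ∨ n = 2 * m + 2) (hn2 : 2 ≤ n)
    {ε y : ℝ} (hε0 : 0 ≤ ε) (hε1 : ε < 1) (h : stdGaussTail y = 1 - binTail (2 * m + 1) ε 0) :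
    |ε - y / √n| ≤ √2 * |y| / √n / n + (√2 * |y| / √n) ^ 3 / 2 := by
  have hpos : 0 < 1 - ε ^ 2 := by nlinarith
  have hlog : 0 ≤ -Real.log (1 - ε ^ 2) := by
    have := Real.log_nonpos hpos.le (by nlinarith)
    linarith
  obtain ⟨u, hu0, hu⟩ : ∃ u : ℝ, 0 ≤ u ∧ √(1 - Real.exp (-u ^ 2)) = ε :=
    ⟨√(-Real.log (1 - ε ^ 2)), Real.sqrt_nonneg _, by
      rw [Real.sq_sqrt hlog, neg_neg, Real.exp_log hpos, sub_sub_cancel, Real.sqrt_sq hε0]⟩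
  have h1 := one_sub_binTail_odd_le_stdGaussTail m hu0
  have h2 := stdGaussTail_le_one_sub_binTail_odd m hu0
  rw [hu, ← h, stdGaussTail_strictAnti.le_iff_ge] at h1 h2
  have hy : 0 ≤ y := le_trans (by positivity) h1
  have h1' : (2 * m + 1) * u ^ 2 ≤ y ^ 2 := by
    have := pow_le_pow_left₀ (by positivity) h1 2
    rwa [mul_pow, Real.sq_sqrt (by positivity)] at this
  have h2' : y ^ 2 ≤ (2 * m + 2) * u ^ 2 := by
    have := pow_le_pow_left₀ hy h2 2
    rwa [mul_pow, Real.sq_sqrt (by positivity)] at this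
  have hnr : (2 : ℝ) ≤ n := by exact_mod_cast hn2
  have hb1 : (n : ℝ) ≤ 2 * m + 2 := by
    have : n ≤ 2 * m + 2 := by omega
    exact_mod_cast this
  have hb2 : (2 * m + 1 : ℝ) ≤ n := by
    have : 2 * m + 1 ≤ n := by omega
    exact_mod_cast this
  have h3 : ((n : ℝ) - 1) * u ^ 2 ≤ y ^ 2 := le_trans (by gcongr; linarith) h1'
  have h4 : y ^ 2 ≤ ((n : ℝ) + 1) * u ^ 2 := h2'.trans (by gcongr ?_ * _; linarith)
  have h5 := abs_div_sqrt_sub_le (by linarith) hu0 hy h3 h4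
  have h6 := abs_sqrt_one_sub_exp_sub_le hu0
  rw [hu] at h6
  rw [abs_of_nonneg hy]
  have hw : u ≤ √2 * y / √n := by
    refine le_of_sq_le_sq ?_ (by positivity)
    rw [div_pow, mul_pow, Real.sq_sqrt (by positivity), Real.sq_sqrt (by positivity),
      le_div_iff₀ (by positivity)]
    nlinarith [sq_nonneg u]
  calc |ε - y / √n| ≤ |ε - u| + |u - y / √n| := abs_sub_le _ _ _
    _ ≤ u ^ 3 / 2 + u / n := by rw [abs_sub_comm u]; gcongr
    _ ≤ (√2 * y / √n) ^ 3 / 2 + √2 * y / √n / n := by gcongr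
    _ = _ := add_comm _ _

theorem abs_add_div_sqrt_le {m n : ℕ} (hn : n = 2 * m + 1 ∨ n = 2 * m + 2) (hn2 : 2 ≤ n)
    {ε z : ℝ} (hε : |ε| < 1) (h : stdGaussTail z = binTail (2 * m + 1) ε 0) :
    |ε + z / √n| ≤ √2 * |z| / √n / n + (√2 * |z| / √n) ^ 3 / 2 := by
  rw [abs_lt] at hε
  rcases le_total 0 ε with h0 | h0
  · have := abs_sub_div_sqrt_le_of_nonneg hn hn2 h0 hε.2 (y := -z) (by rw [stdGaussTail_neg, h])
    rwa [abs_neg, neg_div, sub_neg_eq_add] at this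
  · have := abs_sub_div_sqrt_le_of_nonneg hn hn2 (neg_nonneg.2 h0) (by linarith) (y := z)
      (by rw [binTail_odd_neg, h]; ring)
    rwa [← neg_add', abs_neg] at this

theorem sq_le_of_rpow_lt_stdGaussTail {n : ℕ} (hn : 1 ≤ n) {c z : ℝ}
    (h1 : (n : ℝ) ^ (-c) < stdGaussTail z) (h2 : stdGaussTail z < 1 - (n : ℝ) ^ (-c)) :
    z ^ 2 ≤ 2 * c * Real.log n := by
  have h : (n : ℝ) ^ (-c) < stdGaussTail |z| := by
    rcases abs_choice z with hz | hz <;> rw [hz]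
    · exact h1
    · rw [stdGaussTail_neg]; linarith
  have h3 := h.trans_le (stdGaussTail_le_exp (abs_nonneg z))
  rw [Real.rpow_def_of_pos (by exact_mod_cast hn), Real.exp_lt_exp, sq_abs] at h3
  linarith

/-- The bias with a given tail for an odd number of samples is within `4 / n` of the bias with
the same tail for `n` samples. -/
theorem exists_odd_bias {n : ℕ} (hn : 1 ≤ n) {ε : ℝ} (hε : ε ∈ Set.Icc (-1 : ℝ) 1) :
    ∃ m : ℕ, (n = 2 * m + 1 ∨ n = 2 * m + 2) ∧ ∃ ε' ∈ Set.Icc (-1 : ℝ) 1,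
      binTail (2 * m + 1) ε' 0 = binTail n ε 0 ∧ |ε - ε'| ≤ 4 / n := by
  obtain ⟨m, hm⟩ : ∃ m : ℕ, n = 2 * m + 1 ∨ n = 2 * m + 2 := ⟨(n - 1) / 2, by omega⟩
  refine ⟨m, hm, ?_⟩
  rcases hm with rfl | rfl
  · exact ⟨ε, hε, rfl, by rw [sub_self, abs_zero]; positivity⟩
  have hmono := binTail_strictMonoOn (n := 2 * m + 1) (by omega)
  have hmono' := binTail_strictMonoOn hn
  obtain ⟨ε', hε', h⟩ : binTail (2 * m + 2) ε 0 ∈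
      (fun ε => binTail (2 * m + 1) ε 0) '' Set.Icc (-1 : ℝ) 1 := by
    refine intermediate_value_Icc (by norm_num) (binTail_continuous (by omega)).continuousOn ⟨?_, ?_⟩
    · have := hmono'.monotoneOn (by simp) hε hε.1
      simp only [binTail_neg_one hn] at this
      simpa [binTail_neg_one (show 1 ≤ 2 * m + 1 by omega)] using this
    · have := hmono'.monotoneOn hε (by simp) hε.2
      simp only [binTail_one] at this
      simpa [binTail_one] using this
  simp only at h
  refine ⟨ε', hε', h, ?_⟩
  have hle : ε ≤ ε' := by
    refine (hmono.le_iff_le hε hε').1 ?_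
    simp only [h]
    exact binTail_odd_le_even m hε
  have hs0 : (0 : ℝ) < 2 / (m + 1) := by positivity
  have hge : ε' - 2 / (m + 1) ≤ ε := by
    rcases le_total (-1) (ε' - 2 / (m + 1 : ℝ)) with h0 | h0
    · have := binTail_even_le_odd_shift m rfl ⟨h0, sub_le_sub_right hε'.2 _⟩
      rw [sub_add_cancel, h] at this
      exact (hmono'.le_iff_le ⟨h0, by linarith [hε'.2]⟩ hε).1 this
    · exact h0.trans hε.1
  rw [abs_sub_comm, abs_of_nonneg (sub_nonneg.2 hle)]
  have e : (4 : ℝ) / ((2 * m + 2 : ℕ) : ℝ) = 2 / (m + 1) := by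
    push_cast; field_simp; norm_num
  rw [e]
  linarith

end Quantile

theorem stmt_7 :
    ∃ φ : ℝ → ℝ, (∀ c : ℝ, 0 < c → 0 < φ c) ∧
      ∀ c : ℝ, 0 < c → ∀ n : ℕ, 1 ≤ n → ∀ δ : ℝ,
        (n : ℝ) ^ (-c) < δ → δ < 1 - (n : ℝ) ^ (-c) →
        ∀ ε : ℝ, ε ∈ Set.Icc (-1 : ℝ) 1 → binTail n ε 0 = δ →
        |ε + stdGaussTailInv δ / Real.sqrt n| ≤
          φ c * Real.logb 2 n ^ ((3 : ℝ) / 2) / n := by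
  refine ⟨fun c => 4 + 2 * √c + 4 * √c ^ 3, fun c hc => by positivity, ?_⟩
  intro c hc n hn δ hδ0 hδ1 ε hε hV
  have hn2 : 2 ≤ n := by
    by_contra! hlt
    obtain rfl : n = 1 := by omega
    simp only [Nat.cast_one, Real.one_rpow] at hδ0 hδ1
    linarith
  have hnr : (2 : ℝ) ≤ n := by exact_mod_cast hn2
  have hn0 : (0 : ℝ) < n := by linarith
  have hp : 0 < (n : ℝ) ^ (-c) := by positivity
  have hδ0' : 0 < δ := by linarith
  have hδ1' : δ < 1 := by linarith
  have hz := stdGaussTail_stdGaussTailInv hδ0' hδ1'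
  set z := stdGaussTailInv δ
  obtain ⟨m, hm, ε', hε', hW, hεε'⟩ := exists_odd_bias hn hε
  rw [hV] at hW
  have hε'1 : |ε'| < 1 := by
    rw [abs_lt]
    refine ⟨lt_of_le_of_ne hε'.1 ?_, lt_of_le_of_ne hε'.2 ?_⟩
    · rintro rfl
      rw [binTail_neg_one (by omega)] at hW
      linarith
    · rintro rfl
      rw [binTail_one] at hW
      linarith
  have hmain := abs_add_div_sqrt_le hm hn2 hε'1 (hz.trans hW.symm)
  have hzsq := sq_le_of_rpow_lt_stdGaussTail hn (hz ▸ hδ0) (hz ▸ hδ1)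
  have hL1 : 1 ≤ Real.logb 2 n := by
    rw [Real.le_logb_iff_rpow_le (by norm_num) hn0, Real.rpow_one]; exact hnr
  have hlog : Real.log n ≤ Real.logb 2 n := by
    have h2 : Real.log 2 ≤ 1 := by linarith [Real.log_two_lt_d9]
    rw [Real.logb, le_div_iff₀ (Real.log_pos (by norm_num))]
    exact mul_le_of_le_one_right (Real.log_nonneg (by linarith)) h2
  obtain ⟨l, hl⟩ : ∃ l : ℝ, l = √(Real.logb 2 n) := ⟨_, rfl⟩
  have hl2 : l ^ 2 = Real.logb 2 n := by rw [hl, Real.sq_sqrt (by linarith)]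
  have hl1 : 1 ≤ l := by rw [hl]; exact Real.one_le_sqrt.2 hL1
  have hl3 : Real.logb 2 n ^ ((3 : ℝ) / 2) = l ^ 3 := by
    rw [← hl2, ← Real.rpow_natCast l 2, ← Real.rpow_mul (by linarith), ← Real.rpow_natCast l 3]
    norm_num
  rw [hl3]
  have ha2 : √c ^ 2 = c := Real.sq_sqrt hc.le
  have ha0 : 0 ≤ √c := Real.sqrt_nonneg c
  set a := √c
  set w := √2 * |z| / √n with hw
  have hw0 : 0 ≤ w := by positivity
  have hw2 : w ^ 2 ≤ (2 * a * l) ^ 2 / n := by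
    rw [hw, div_pow, mul_pow, Real.sq_sqrt (by norm_num), Real.sq_sqrt hn0.le, sq_abs]
    gcongr
    calc 2 * z ^ 2 ≤ 2 * (2 * c * Real.logb 2 n) := by
          have := mul_le_mul_of_nonneg_left hlog (by positivity : 0 ≤ 2 * c)
          linarith
      _ = (2 * a * l) ^ 2 := by rw [← hl2, ← ha2]; ring
  have hw1 : w ≤ 2 * a * l := by
    refine le_of_sq_le_sq (hw2.trans (div_le_self (by positivity) (by linarith))) (by positivity)
  have hl13 : l ≤ l ^ 3 := le_self_pow₀ hl1 (by norm_num)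
  calc |ε + z / √n| = |(ε - ε') + (ε' + z / √n)| := by congr 1; ring
    _ ≤ |ε - ε'| + |ε' + z / √n| := abs_add_le _ _
    _ ≤ 4 / n + (w / n + w ^ 3 / 2) := add_le_add hεε' hmain
    _ = 4 * 1 / n + (w / n + w * w ^ 2 / 2) := by ring
    _ ≤ 4 * l ^ 3 / n + (2 * a * l ^ 3 / n + (2 * a * l) * ((2 * a * l) ^ 2 / n) / 2) := by
        gcongr
        · exact one_le_pow₀ hl1
        · exact hw1.trans (by gcongr)
    _ = (4 + 2 * a + 4 * a ^ 3) * l ^ 3 / n := by ring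
end

section
/- There exists a universal constant ξ > 0 such that for every n ∈ ℕ with n ≥ 1 and all p, t ∈ ℤ with p even, |p|, |t| ≤ n^{3/5} and Hyp(2n,p,n)(t) > 0, it holds that |Hyp(2n,p,n)(t) − c₀| ≤ ξ·((n + |p|³ + |t|³)/n²)·c₀, where c₀ := (2/√(π·n))·e^{-(t − p/2)²/n}. -/
noncomputable def hypPMF (n : ℕ) (p : ℤ) (l : ℕ) (k : ℤ) : ℝ :=
  if ((l : ℤ) + k) % 2 = 0 ∧ -(l : ℤ) ≤ k ∧ k ≤ (l : ℤ) then
    ((((n : ℤ) + p) / 2).toNat.choose (((l : ℤ) + k) / 2).toNat *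
        (((n : ℤ) - p) / 2).toNat.choose (((l : ℤ) - k) / 2).toNat : ℝ) / (n.choose l : ℝ)
  else 0

noncomputable def hypTail (n : ℕ) (p : ℤ) (l : ℕ) (k : ℤ) : ℝ :=
  ∑ t ∈ Finset.Icc k (l : ℤ), hypPMF n p l t

open Filter in
/-- A two-sided form of Stirling's formula with an explicit error term. -/
theorem abs_log_factorial_sub_le {k : ℕ} (hk : k ≠ 0) :
    |Real.log (k.factorial : ℝ) -
        (k * Real.log k - k + Real.log k / 2 + Real.log (2 * Real.pi) / 2)| ≤ 1 / (12 * k) := by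
  have hlow := Stirling.le_log_factorial_stirling hk
  have hmono : Monotone fun m : ℕ =>
      Real.log (Stirling.stirlingSeq (m + 1)) - 1 / (12 * ((m + 1 : ℕ) : ℝ)) := by
    refine monotone_nat_of_le_succ fun m => ?_
    have h := Stirling.log_stirlingSeq_sdiff_le (m + 1)
    have e : (1 : ℝ) / (12 * ((m + 1 : ℕ) : ℝ) * (((m + 1 : ℕ) : ℝ) + 1)) =
        1 / (12 * ((m + 1 : ℕ) : ℝ)) - 1 / (12 * ((m + 1 + 1 : ℕ) : ℝ)) := by
      push_cast
      field_simp
      ring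
    rw [e] at h
    linarith
  have hlim : Tendsto (fun m : ℕ =>
      Real.log (Stirling.stirlingSeq (m + 1)) - 1 / (12 * ((m + 1 : ℕ) : ℝ))) atTop
      (nhds (Real.log (√Real.pi) - 0)) := by
    refine Tendsto.sub ?_ ?_
    · have h := (tendsto_add_atTop_iff_nat 1).2 Stirling.tendsto_stirlingSeq_sqrt_pi
      exact h.log (by positivity)
    · have h := (tendsto_one_div_add_atTop_nhds_zero_nat (𝕜 := ℝ)).const_mul (1 / 12)
      rw [mul_zero] at h
      refine h.congr fun m => ?_
      push_cast
      field_simp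
  obtain ⟨m, rfl⟩ := Nat.exists_eq_succ_of_ne_zero hk
  have hup := hmono.ge_of_tendsto hlim m
  simp only [sub_zero] at hup
  rw [Stirling.log_stirlingSeq_formula, Real.log_sqrt Real.pi_pos.le,
    Real.log_div (by positivity) (by positivity), Real.log_exp,
    Real.log_mul (by norm_num) (by positivity)] at hup
  rw [Real.log_mul (by norm_num) (by positivity)] at hlow ⊢
  have : (0 : ℝ) ≤ 1 / (12 * ((m + 1 : ℕ) : ℝ)) := by positivity
  simp only [Nat.succ_eq_add_one] at *
  rw [abs_le]
  constructor <;> linarith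

theorem abs_log_one_add_add_log_one_sub_le {x : ℝ} (hx : |x| ≤ 1 / 2) :
    |Real.log (1 + x) + Real.log (1 - x)| ≤ 2 * x ^ 2 := by
  obtain ⟨h1, h2⟩ := abs_le.1 hx
  have hsq : x ^ 2 ≤ 1 / 4 := by nlinarith
  rw [← Real.log_mul (by linarith) (by linarith), show (1 + x) * (1 - x) = 1 - x ^ 2 by ring]
  have hpos : 0 < 1 - x ^ 2 := by linarith
  have hu := Real.log_le_sub_one_of_pos hpos
  have hl := Real.one_sub_inv_le_log_of_pos hpos
  have hi : (1 - x ^ 2)⁻¹ ≤ 1 + 2 * x ^ 2 := by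
    rw [inv_le_iff_one_le_mul₀ hpos]
    nlinarith [sq_nonneg x]
  rw [abs_le]
  constructor <;> nlinarith [sq_nonneg x]

theorem abs_log_one_sub_taylor_three_le {x : ℝ} (hx : |x| ≤ 1 / 2) :
    |x + x ^ 2 / 2 + x ^ 3 / 3 + Real.log (1 - x)| ≤ 2 * x ^ 4 := by
  have h := Real.abs_log_sub_add_sum_range_le (x := x) (by linarith) 3
  norm_num [Finset.sum_range_succ] at h
  refine h.trans ?_
  have e : |x| ^ 4 = x ^ 4 := by rw [← abs_pow, abs_of_nonneg (by positivity)]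
  rw [e, div_le_iff₀ (by linarith)]
  nlinarith [show 0 ≤ x ^ 4 by positivity]

theorem abs_entropy_sub_sq_le {x : ℝ} (hx : |x| ≤ 1 / 2) :
    |(1 + x) * Real.log (1 + x) + (1 - x) * Real.log (1 - x) - x ^ 2| ≤ 5 * x ^ 4 := by
  have h1 := abs_le.1 (abs_log_one_sub_taylor_three_le hx)
  have h2 := abs_le.1 (abs_log_one_sub_taylor_three_le (x := -x) (by rwa [abs_neg]))
  rw [sub_neg_eq_add] at h2
  obtain ⟨hx1, hx2⟩ := abs_le.1 hx
  have p : 0 ≤ 1 + x := by linarith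
  have m : 0 ≤ 1 - x := by linarith
  have a1 := mul_le_mul_of_nonneg_left h1.1 m
  have a2 := mul_le_mul_of_nonneg_left h1.2 m
  have b1 := mul_le_mul_of_nonneg_left h2.1 p
  have b2 := mul_le_mul_of_nonneg_left h2.2 p
  have q : 0 ≤ x ^ 4 := by positivity
  rw [abs_le]
  constructor <;> nlinarith

/-- Stirling's formula for a product of two factorials with arguments `r (1 ± x)`. -/
theorem abs_log_factorial_pair_sub_le {k l : ℕ} {r x : ℝ} (hr : 0 < r) (hx : |x| ≤ 1 / 2)
    (hk : (k : ℝ) = r * (1 + x)) (hl : (l : ℝ) = r * (1 - x)) :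
    |Real.log (k.factorial : ℝ) + Real.log (l.factorial : ℝ) -
        (2 * r * Real.log r - 2 * r + Real.log r + Real.log (2 * Real.pi) + r * x ^ 2)| ≤
      5 * (r * x ^ 4) + x ^ 2 + 1 / (3 * r) := by
  obtain ⟨hx1, hx2⟩ := abs_le.1 hx
  have hk2 : r / 2 ≤ k := by rw [hk]; nlinarith
  have hl2 : r / 2 ≤ l := by rw [hl]; nlinarith
  have hk0 : k ≠ 0 := by rintro rfl; norm_num at hk2; linarith
  have hl0 : l ≠ 0 := by rintro rfl; norm_num at hl2; linarith
  have error {j : ℕ} (hj : r / 2 ≤ j) : 1 / (12 * (j : ℝ)) ≤ 1 / (3 * r) / 2 := by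
    rw [div_div]
    exact one_div_le_one_div_of_le (by positivity) (by linarith)
  have sk := abs_le.1 ((abs_log_factorial_sub_le hk0).trans (error hk2))
  have sl := abs_le.1 ((abs_log_factorial_sub_le hl0).trans (error hl2))
  have hL := abs_le.1 (abs_log_one_add_add_log_one_sub_le hx)
  have hH := abs_le.1 (abs_entropy_sub_sq_le hx)
  have hH1 := mul_le_mul_of_nonneg_left hH.1 hr.le
  have hH2 := mul_le_mul_of_nonneg_left hH.2 hr.le
  have lk : Real.log (k : ℝ) = Real.log r + Real.log (1 + x) := by
    rw [hk, Real.log_mul hr.ne' (by linarith)]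
  have ll : Real.log (l : ℝ) = Real.log r + Real.log (1 - x) := by
    rw [hl, Real.log_mul hr.ne' (by linarith)]
  rw [lk, hk] at sk
  rw [ll, hl] at sl
  rw [abs_le]
  constructor <;> nlinarith

theorem hypPMF_eq_of_pos {n : ℕ} {p t : ℤ} (hp : p % 2 = 0) (hpn : |p| ≤ n)
    (hpos : 0 < hypPMF (2 * n) p n t) :
    ∃ a b c d : ℕ, 2 * (a : ℤ) = n + t ∧ 2 * (b : ℤ) = n - t ∧ 2 * (c : ℤ) = n + (t - p) ∧
      2 * (d : ℤ) = n - (t - p) ∧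
      hypPMF (2 * n) p n t =
        ((a + d).choose a * (b + c).choose b : ℝ) / ((2 * n).choose n : ℝ) := by
  unfold hypPMF at hpos ⊢
  split_ifs at hpos ⊢ with h
  · obtain ⟨h1, h2, h3⟩ := h
    obtain ⟨hpn1, hpn2⟩ := abs_le.1 hpn
    have hle {u v : ℕ} (huv : (u.choose v : ℝ) ≠ 0) : v ≤ u := by
      by_contra! hlt
      exact huv (by rw [Nat.choose_eq_zero_of_lt hlt, Nat.cast_zero])
    have hnum : ((((((2 * n : ℕ) : ℤ) + p) / 2).toNat.choose (((n : ℤ) + t) / 2).toNat : ℝ) *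
        (((((2 * n : ℕ) : ℤ) - p) / 2).toNat.choose (((n : ℤ) - t) / 2).toNat : ℝ)) ≠ 0 := by
      intro h0
      rw [h0, zero_div] at hpos
      exact hpos.false
    have hA := hle (left_ne_zero_of_mul hnum)
    have hB := hle (right_ne_zero_of_mul hnum)
    refine ⟨(((n : ℤ) + t) / 2).toNat, (((n : ℤ) - t) / 2).toNat,
      (((n : ℤ) + (t - p)) / 2).toNat, (((n : ℤ) - (t - p)) / 2).toNat,
      by omega, by omega, by omega, by omega, ?_⟩
    congr 5 <;> omega
  · exact absurd hpos (lt_irrefl _)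

theorem abs_exp_sub_one_le_mul_exp (x : ℝ) : |Real.exp x - 1| ≤ |x| * Real.exp |x| := by
  have h1 := Real.add_one_le_exp x
  have h2 := Real.add_one_le_exp (-x)
  have h3 : Real.exp x * Real.exp (-x) = 1 := by rw [← Real.exp_add]; simp
  have h4 := Real.exp_le_exp.2 (le_abs_self x)
  have h5 := Real.one_le_exp (abs_nonneg x)
  have h6 := Real.exp_pos x
  have h7 := abs_nonneg x
  rw [abs_le]
  constructor
  · nlinarith [neg_abs_le x]
  · calc Real.exp x - 1 ≤ x * Real.exp x := by nlinarith
      _ ≤ |x| * Real.exp x := by gcongr; exact le_abs_self x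
      _ ≤ |x| * Real.exp |x| := by gcongr

theorem log_choose_add (a d : ℕ) :
    Real.log ((a + d).choose a : ℝ) =
      Real.log ((a + d).factorial : ℝ) - Real.log (a.factorial : ℝ) -
        Real.log (d.factorial : ℝ) := by
  rw [Nat.cast_add_choose ℝ, Real.log_div (by positivity) (by positivity),
    Real.log_mul (by positivity) (by positivity)]
  ring

theorem sq_le_one_add_cube {u : ℝ} (hu : 0 ≤ u) : u ^ 2 ≤ 1 + u ^ 3 := by
  rcases le_total u 1 with h | h
  · nlinarith [pow_nonneg hu 3]
  · nlinarith [sq_nonneg u]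

theorem add_cube_le_four_mul {u v : ℝ} (hu : 0 ≤ u) (hv : 0 ≤ v) :
    (u + v) ^ 3 ≤ 4 * (u ^ 3 + v ^ 3) := by
  nlinarith [mul_nonneg (add_nonneg hu hv) (sq_nonneg (u - v))]

theorem sq_and_mul_fourth_le {r u w : ℝ} (hr : 0 < r) (hw : |w| ≤ 1 / 2) (hwu : |w| ≤ u / r) :
    w ^ 2 ≤ u ^ 2 / r ^ 2 ∧ r * w ^ 4 ≤ u ^ 3 / r ^ 2 := by
  constructor
  · rw [← sq_abs, ← div_pow]
    gcongr
  · calc r * w ^ 4 = r * |w| ^ 4 := by rw [(show Even 4 by decide).pow_abs]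
      _ ≤ r * |w| ^ 3 := by
        gcongr ?_ * ?_
        exact pow_le_pow_of_le_one (abs_nonneg w) (by linarith) (by norm_num)
      _ ≤ r * (u / r) ^ 3 := by gcongr
      _ = u ^ 3 / r ^ 2 := by field_simp

/-- The logarithmic form of the Gaussian approximation, in the range where all
factorials have arguments of order `n`. -/
theorem abs_log_choose_ratio_sub_le {n a b c d : ℕ} {p t : ℝ} (hn : 1 ≤ n)
    (ha : (a : ℝ) = (n + t) / 2) (hb : (b : ℝ) = (n - t) / 2)
    (hc : (c : ℝ) = (n + (t - p)) / 2) (hd : (d : ℝ) = (n - (t - p)) / 2)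
    (hp : |p| ≤ n / 4) (ht : |t| ≤ n / 4) :
    |Real.log (((a + d).choose a * (b + c).choose b : ℝ) / ((2 * n).choose n : ℝ)) -
        Real.log (2 / Real.sqrt (Real.pi * n) * Real.exp (-(t - p / 2) ^ 2 / n))| ≤
      26 * ((n + |p| ^ 3 + |t| ^ 3) / (n : ℝ) ^ 2) := by
  have hn1 : (1 : ℝ) ≤ n := by exact_mod_cast hn
  have hn0 : (0 : ℝ) < n := by linarith
  have chpos (u v : ℕ) : ((u + v).choose u : ℝ) ≠ 0 := by
    exact_mod_cast (Nat.choose_pos (Nat.le_add_right u v)).ne'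
  have hP := abs_nonneg p
  have hT := abs_nonneg t
  have htp : |t - p| ≤ |t| + |p| := abs_sub t p
  obtain ⟨x, hx⟩ : ∃ x, x = p / (2 * n) := ⟨_, rfl⟩
  obtain ⟨y, hy⟩ : ∃ y, y = t / n := ⟨_, rfl⟩
  obtain ⟨z, hz⟩ : ∃ z, z = (t - p) / n := ⟨_, rfl⟩
  have ax : |x| = |p| / (2 * n) := by
    rw [hx, abs_div, abs_of_pos (show (0 : ℝ) < 2 * n by positivity)]
  have ay : |y| = |t| / n := by rw [hy, abs_div, abs_of_pos hn0]
  have az : |z| = |t - p| / n := by rw [hz, abs_div, abs_of_pos hn0]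
  have bx : |x| ≤ 1 / 2 := by rw [ax, div_le_iff₀ (by positivity)]; linarith
  have bY : |y| ≤ 1 / 2 := by rw [ay, div_le_iff₀ (by positivity)]; linarith
  have bz : |z| ≤ 1 / 2 := by rw [az, div_le_iff₀ (by positivity)]; linarith
  have s1 := abs_log_factorial_pair_sub_le (k := a + d) (l := b + c) hn0 bx
    (by push_cast; rw [ha, hd, hx]; field_simp; ring)
    (by push_cast; rw [hb, hc, hx]; field_simp; ring)
  have s2 := abs_log_factorial_pair_sub_le (k := a) (l := b) (half_pos hn0) bY
    (by rw [ha, hy]; field_simp) (by rw [hb, hy]; field_simp)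
  have s3 := abs_log_factorial_pair_sub_le (k := c) (l := d) (half_pos hn0) bz
    (by rw [hc, hz]; field_simp) (by rw [hd, hz]; field_simp)
  have s4 := abs_log_factorial_sub_le (k := n) (by omega)
  have s5 := abs_log_factorial_sub_le (k := n + n) (by omega)
  have hLHS : Real.log (((a + d).choose a * (b + c).choose b : ℝ) / ((2 * n).choose n : ℝ)) =
      Real.log ((a + d).factorial : ℝ) + Real.log ((b + c).factorial : ℝ)
        - (Real.log (a.factorial : ℝ) + Real.log (b.factorial : ℝ))
        - (Real.log (c.factorial : ℝ) + Real.log (d.factorial : ℝ))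
        + 2 * Real.log (n.factorial : ℝ) - Real.log ((n + n).factorial : ℝ) := by
    rw [two_mul, Real.log_div (mul_ne_zero (chpos _ _) (chpos _ _)) (chpos _ _),
      Real.log_mul (chpos _ _) (chpos _ _), log_choose_add, log_choose_add, log_choose_add]
    ring
  have hRHS : Real.log (2 / Real.sqrt (Real.pi * n) * Real.exp (-(t - p / 2) ^ 2 / n)) =
      Real.log 2 - (Real.log Real.pi + Real.log n) / 2 +
        (n * x ^ 2 - n / 2 * y ^ 2 - n / 2 * z ^ 2) := by
    rw [Real.log_mul (by positivity) (by positivity), Real.log_div (by positivity) (by positivity),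
      Real.log_sqrt (by positivity), Real.log_mul (by positivity) (by positivity), Real.log_exp,
      hx, hy, hz]
    field_simp
    ring
  have l2pi : Real.log (2 * Real.pi) = Real.log 2 + Real.log Real.pi :=
    Real.log_mul (by norm_num) (by positivity)
  have lhalf : Real.log ((n : ℝ) / 2) = Real.log n - Real.log 2 :=
    Real.log_div (by positivity) (by norm_num)
  have ldouble : Real.log ((n + n : ℕ) : ℝ) = Real.log 2 + Real.log n := by
    push_cast
    rw [← two_mul, Real.log_mul (by norm_num) (by positivity)]
  obtain ⟨Q, hQ⟩ : ∃ Q, Q = (n + |p| ^ 3 + |t| ^ 3) / (n : ℝ) ^ 2 := ⟨_, rfl⟩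
  have hP3 : 0 ≤ |p| ^ 3 := by positivity
  have hT3 : 0 ≤ |t| ^ 3 := by positivity
  have hS {w : ℝ} {u m : ℝ} (hu : 0 ≤ u) (hw : |w| ≤ 1 / 2) (hwu : |w| ≤ u / n)
      (hu2 : u ^ 2 ≤ m * (n + |p| ^ 3 + |t| ^ 3)) (hu3 : u ^ 3 ≤ m * (n + |p| ^ 3 + |t| ^ 3)) :
      w ^ 2 ≤ m * Q ∧ n * w ^ 4 ≤ m * Q := by
    obtain ⟨h2, h4⟩ := sq_and_mul_fourth_le hn0 hw hwu
    rw [hQ, ← mul_div_assoc]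
    exact ⟨h2.trans (by gcongr), h4.trans (by gcongr)⟩
  have hsP := sq_le_one_add_cube hP
  have hsT := sq_le_one_add_cube hT
  have qn : 1 / (n : ℝ) ≤ Q := by
    calc 1 / (n : ℝ) = n / (n : ℝ) ^ 2 := by field_simp
      _ ≤ Q := by rw [hQ]; gcongr; linarith
  obtain ⟨qx2, qx4⟩ := hS (m := 1) hP bx
    (by rw [ax]; exact div_le_div_of_nonneg_left hP hn0 (by linarith))
    (by linarith) (by linarith)
  obtain ⟨qy2, qy4⟩ := hS (m := 1) hT bY ay.le (by linarith) (by linarith)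
  obtain ⟨qz2, qz4⟩ := hS (m := 4) (add_nonneg hT hP) bz (by rw [az]; gcongr)
    (by linarith [add_sq_le (a := |t|) (b := |p|)])
    (by linarith [add_cube_le_four_mul hT hP])
  rw [hLHS, hRHS, ← hQ]
  rw [lhalf, l2pi] at s2 s3
  rw [l2pi] at s1 s4 s5
  rw [ldouble] at s5
  push_cast at s5
  have e1 : 1 / (3 * (n : ℝ)) = 1 / 3 * (1 / n) := by field_simp
  have e2 : 1 / (3 * ((n : ℝ) / 2)) = 2 / 3 * (1 / n) := by field_simp
  have e4 : 1 / (12 * (n : ℝ)) = 1 / 12 * (1 / n) := by field_simp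
  have e5 : 1 / (12 * ((n : ℝ) + n)) = 1 / 24 * (1 / n) := by field_simp; ring
  rw [e1] at s1
  rw [e2] at s2 s3
  rw [e4] at s4
  rw [e5] at s5
  rw [abs_le] at s1 s2 s3 s4 s5 ⊢
  constructor <;> linarith

theorem rpow_three_fifths_le_self {n : ℕ} (hn : 1 ≤ n) : (n : ℝ) ^ ((3 : ℝ) / 5) ≤ n :=
  Real.rpow_le_self_of_one_le (by exact_mod_cast hn) (by norm_num)

theorem rpow_three_fifths_le_quarter {n : ℕ} (hn : 32 ≤ n) :
    (n : ℝ) ^ ((3 : ℝ) / 5) ≤ n / 4 := by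
  have hn0 : (0 : ℝ) < n := by exact_mod_cast (by omega : 0 < n)
  have h4 : (4 : ℝ) ≤ (n : ℝ) ^ ((2 : ℝ) / 5) := by
    calc (4 : ℝ) = (32 : ℝ) ^ ((2 : ℝ) / 5) := by
          rw [show (32 : ℝ) = 2 ^ (5 : ℝ) by norm_num, ← Real.rpow_mul (by norm_num)]
          norm_num
      _ ≤ (n : ℝ) ^ ((2 : ℝ) / 5) := by
          gcongr
          exact_mod_cast hn
  have hmul : (n : ℝ) ^ ((3 : ℝ) / 5) * (n : ℝ) ^ ((2 : ℝ) / 5) = n := by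
    rw [← Real.rpow_add hn0]
    norm_num
  nlinarith [Real.rpow_nonneg hn0.le ((3 : ℝ) / 5)]

theorem cube_le_sq_of_le_rpow {n : ℕ} (hn : 1 ≤ n) {u : ℝ} (hu : 0 ≤ u)
    (h : u ≤ (n : ℝ) ^ ((3 : ℝ) / 5)) : u ^ 3 ≤ (n : ℝ) ^ 2 := by
  have hn1 : (1 : ℝ) ≤ n := by exact_mod_cast hn
  calc u ^ 3 ≤ ((n : ℝ) ^ ((3 : ℝ) / 5)) ^ 3 := by gcongr
    _ = (n : ℝ) ^ ((9 : ℝ) / 5) := by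
        rw [← Real.rpow_natCast, ← Real.rpow_mul (by positivity)]
        norm_num
    _ ≤ (n : ℝ) ^ (2 : ℝ) := Real.rpow_le_rpow_of_exponent_le hn1 (by norm_num)
    _ = (n : ℝ) ^ 2 := by norm_cast

theorem choose_ratio_le {n a b c d : ℕ} (h : a + d + (b + c) = 2 * n) :
    ((a + d).choose a * (b + c).choose b : ℝ) / ((2 * n).choose n : ℝ) ≤ 4 ^ n := by
  have h1 : (1 : ℝ) ≤ ((2 * n).choose n : ℝ) := by
    exact_mod_cast Nat.choose_pos (by omega : n ≤ 2 * n)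
  have h2 : (a + d).choose a * (b + c).choose b ≤ 4 ^ n :=
    calc (a + d).choose a * (b + c).choose b ≤ 2 ^ (a + d) * 2 ^ (b + c) :=
          Nat.mul_le_mul (Nat.choose_le_two_pow _ _) (Nat.choose_le_two_pow _ _)
      _ = 4 ^ n := by rw [← pow_add, h, pow_mul]; norm_num
  refine (div_le_self (by positivity) h1).trans ?_
  exact_mod_cast h2

theorem exp_neg_le_gaussian {n : ℕ} (hn : 1 ≤ n) (hn' : n ≤ 32) {p t : ℝ}
    (hp : |p| ≤ n) (ht : |t| ≤ n) :
    Real.exp (-128) / 16 ≤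
      2 / Real.sqrt (Real.pi * n) * Real.exp (-(t - p / 2) ^ 2 / n) := by
  have hn1 : (1 : ℝ) ≤ n := by exact_mod_cast hn
  have hn2 : (n : ℝ) ≤ 32 := by exact_mod_cast hn'
  have hs : Real.sqrt (Real.pi * n) ≤ 16 := by
    rw [Real.sqrt_le_left (by norm_num)]
    nlinarith [Real.pi_le_four, Real.pi_pos]
  have hs0 : 0 < Real.sqrt (Real.pi * n) := by positivity
  have h1 : (1 : ℝ) / 16 ≤ 2 / Real.sqrt (Real.pi * n) := by
    rw [div_le_div_iff₀ (by norm_num) hs0]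
    linarith
  have h2 : (-128 : ℝ) ≤ -(t - p / 2) ^ 2 / n := by
    rw [le_div_iff₀ (by linarith)]
    obtain ⟨p1, p2⟩ := abs_le.1 hp
    obtain ⟨t1, t2⟩ := abs_le.1 ht
    have : (t - p / 2) ^ 2 ≤ (2 * n) ^ 2 := by
      apply sq_le_sq'
      all_goals linarith
    nlinarith
  calc Real.exp (-128) / 16 = 1 / 16 * Real.exp (-128) := by ring
    _ ≤ _ := by gcongr

theorem abs_sub_le_of_log_sub_le {u v E M : ℝ} (hu : 0 < u) (hv : 0 < v)
    (h : |Real.log u - Real.log v| ≤ E) (hE : E ≤ M) : |u - v| ≤ E * Real.exp M * v := by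
  have e : u - v = (Real.exp (Real.log u - Real.log v) - 1) * v := by
    rw [Real.exp_sub, Real.exp_log hu, Real.exp_log hv]
    field_simp
  have hE0 : 0 ≤ E := (abs_nonneg _).trans h
  rw [e, abs_mul, abs_of_pos hv]
  gcongr
  refine (abs_exp_sub_one_le_mul_exp _).trans ?_
  gcongr
  exact h.trans hE

theorem stmt_12 :
    ∃ ξ : ℝ, 0 < ξ ∧ ∀ n : ℕ, 1 ≤ n → ∀ p t : ℤ, p % 2 = 0 →
      |(p : ℝ)| ≤ (n : ℝ) ^ ((3 : ℝ) / 5) → |(t : ℝ)| ≤ (n : ℝ) ^ ((3 : ℝ) / 5) →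
      0 < hypPMF (2 * n) p n t →
      |hypPMF (2 * n) p n t -
          2 / Real.sqrt (Real.pi * n) * Real.exp (-((t : ℝ) - (p : ℝ) / 2) ^ 2 / n)| ≤
        ξ * (((n : ℝ) + |(p : ℝ)| ^ 3 + |(t : ℝ)| ^ 3) / (n : ℝ) ^ 2) *
          (2 / Real.sqrt (Real.pi * n) * Real.exp (-((t : ℝ) - (p : ℝ) / 2) ^ 2 / n)) := by
  obtain ⟨K, hK⟩ : ∃ K : ℝ, K = 4 ^ 32 / (Real.exp (-128) / 16) + 1 := ⟨_, rfl⟩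
  have hK0 : 0 < K := by rw [hK]; positivity
  refine ⟨26 * Real.exp 78 + 32 * K, by positivity, ?_⟩
  intro n hn p t hp hpn htn hpos
  have hn1 : (1 : ℝ) ≤ n := by exact_mod_cast hn
  have hn0 : (0 : ℝ) < n := by linarith
  have hpn' : |(p : ℝ)| ≤ n := hpn.trans (rpow_three_fifths_le_self hn)
  have htn' : |(t : ℝ)| ≤ n := htn.trans (rpow_three_fifths_le_self hn)
  obtain ⟨a, b, c, d, ha, hb, hc, hd, hval⟩ :=
    hypPMF_eq_of_pos hp (by exact_mod_cast hpn') hpos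
  rw [hval] at hpos ⊢
  have hG : 0 < 2 / Real.sqrt (Real.pi * n) *
      Real.exp (-((t : ℝ) - (p : ℝ) / 2) ^ 2 / n) := by positivity
  have hQ : 1 / (n : ℝ) ≤ ((n : ℝ) + |(p : ℝ)| ^ 3 + |(t : ℝ)| ^ 3) / (n : ℝ) ^ 2 := by
    rw [div_le_div_iff₀ hn0 (by positivity)]
    nlinarith [pow_nonneg (abs_nonneg (p : ℝ)) 3, pow_nonneg (abs_nonneg (t : ℝ)) 3]
  have hQ0 := (one_div_pos.2 hn0).trans_le hQ
  rcases le_total 32 n with h32 | h32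
  · have hcast {u : ℕ} {v : ℤ} (h : 2 * (u : ℤ) = v) : (u : ℝ) = v / 2 := by
      have : 2 * (u : ℝ) = v := by exact_mod_cast h
      linarith
    have hlog := abs_log_choose_ratio_sub_le (p := p) (t := t) hn
      (by simpa using hcast ha) (by simpa using hcast hb) (by simpa using hcast hc)
      (by simpa using hcast hd) (hpn.trans (rpow_three_fifths_le_quarter h32))
      (htn.trans (rpow_three_fifths_le_quarter h32))
    have hQ3 : ((n : ℝ) + |(p : ℝ)| ^ 3 + |(t : ℝ)| ^ 3) / (n : ℝ) ^ 2 ≤ 3 := by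
      rw [div_le_iff₀ (by positivity)]
      nlinarith [cube_le_sq_of_le_rpow hn (abs_nonneg _) hpn,
        cube_le_sq_of_le_rpow hn (abs_nonneg _) htn]
    refine (abs_sub_le_of_log_sub_le hpos hG hlog (M := 78) (by linarith)).trans ?_
    refine mul_le_mul_of_nonneg_right ?_ hG.le
    nlinarith [mul_pos hK0 hQ0]
  · have hup := (choose_ratio_le (n := n) (a := a) (b := b) (c := c) (d := d) (by omega)).trans
      (pow_le_pow_right₀ (by norm_num : (1 : ℝ) ≤ 4) h32)
    have hlow := exp_neg_le_gaussian hn h32 hpn' htn'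
    have hKG : 4 ^ 32 + 2 / Real.sqrt (Real.pi * n) *
        Real.exp (-((t : ℝ) - (p : ℝ) / 2) ^ 2 / n) ≤ K * (2 / Real.sqrt (Real.pi * n) *
        Real.exp (-((t : ℝ) - (p : ℝ) / 2) ^ 2 / n)) := by
      rw [hK, add_mul, one_mul]
      refine add_le_add_left ?_ _
      rw [div_mul_eq_mul_div, le_div_iff₀ (by positivity)]
      exact mul_le_mul_of_nonneg_left hlow (by norm_num)
    have hQ32 : 1 / 32 ≤ ((n : ℝ) + |(p : ℝ)| ^ 3 + |(t : ℝ)| ^ 3) / (n : ℝ) ^ 2 := by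
      refine le_trans ?_ hQ
      gcongr
      exact_mod_cast h32
    refine le_trans (b := K * (2 / Real.sqrt (Real.pi * n) *
        Real.exp (-((t : ℝ) - (p : ℝ) / 2) ^ 2 / n))) ?_ ?_
    · rw [abs_le]
      constructor <;> linarith
    · refine mul_le_mul_of_nonneg_right ?_ hG.le
      nlinarith [mul_pos (Real.exp_pos 78) hQ0]
end

section
/- There exists a function φ : ℝ_{>0} → ℝ_{>0} such that for every c > 0, every n ∈ ℕ with n ≥ 1, and all p, t, x, x' ∈ ℤ with p even, Hyp(2n,p,n)(t−x) > 0, Hyp(2n,p,n)(t−x') > 0 and |p|, |t|, |x|, |x'| ≤ c·√(n·log n), it holds that |Hyp(2n,p,n)(t−x')/Hyp(2n,p,n)(t−x) − E₀| ≤ φ(c)·(log^{1.5} n / √n)·E₀, where E₀ := exp((−2·(t − p/2)·x + x² + 2·(t − p/2)·x' − x'²)/n). -/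
/-- The unnormalised hypergeometric weight: the number of `n`-subsets of a disjoint union of an
`A`-set and a `B`-set that meet the `A`-set in `a` points. -/
def hypWeight (A B n a : ℕ) : ℝ := A.choose a * B.choose (n - a)

theorem hypWeight_nonneg (A B n a : ℕ) : 0 ≤ hypWeight A B n a := by
  unfold hypWeight; positivity

theorem one_le_hypWeight_of_pos {A B n a : ℕ} (h : 0 < hypWeight A B n a) :
    1 ≤ hypWeight A B n a := by
  unfold hypWeight at *
  exact_mod_cast h

theorem hypWeight_le (A B n a : ℕ) : hypWeight A B n a ≤ 2 ^ (A + B) := by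
  unfold hypWeight
  rw [pow_add]
  exact_mod_cast Nat.mul_le_mul (Nat.choose_le_two_pow A a) (Nat.choose_le_two_pow B (n - a))

theorem exists_hypWeight_of_hypPMF_pos {n : ℕ} {q k : ℤ} (h : 0 < hypPMF (2 * n) (2 * q) n k) :
    ∃ a ≤ n, k = 2 * a - n ∧ hypPMF (2 * n) (2 * q) n k =
      hypWeight (n + q).toNat (n - q).toNat n a / (2 * n).choose n := by
  unfold hypPMF at *
  split_ifs at h ⊢ with hk
  · obtain ⟨h1, h2, h3⟩ := hk
    refine ⟨((n + k) / 2).toNat, by omega, by omega, ?_⟩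
    have e1 : ((((2 * n : ℕ) : ℤ) + 2 * q) / 2) = n + q := by push_cast; omega
    have e2 : ((((2 * n : ℕ) : ℤ) - 2 * q) / 2) = n - q := by push_cast; omega
    have e3 : (((n : ℤ) - k) / 2).toNat = n - (((n : ℤ) + k) / 2).toNat := by omega
    rw [e1, e2, e3, hypWeight]
  · exact absurd h (lt_irrefl 0)

theorem abs_log_sub_le {u r : ℝ} (hr : r ≤ 1 / 2) (hu : |u - 1| ≤ r) :
    1 / 2 ≤ u ∧ |Real.log u - (u - 1)| ≤ 2 * r ^ 2 := by
  have h := abs_le.1 hu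
  have hu2 : 1 / 2 ≤ u := by linarith
  have hu0 : 0 < u := by linarith
  refine ⟨hu2, abs_le.2 ⟨?_, ?_⟩⟩
  · have h1 := Real.one_sub_inv_le_log_of_pos hu0
    have h2 : (u - 1) - (1 - u⁻¹) = (u - 1) ^ 2 * u⁻¹ := by field_simp
    have h3 : u⁻¹ ≤ 2 := by
      rw [inv_le_comm₀ hu0 two_pos]; linarith
    have h4 : (u - 1) ^ 2 ≤ r ^ 2 := sq_le_sq' h.1 h.2
    nlinarith [sq_nonneg (u - 1), inv_pos.2 hu0]
  · nlinarith [Real.log_le_sub_one_of_pos hu0, sq_nonneg r]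

theorem hypWeight_succ {A B n a : ℕ} (ha : a < n) (hA : a ≤ A) (hB : n ≤ B + a + 1) :
    hypWeight A B n (a + 1) * ((a + 1) * (B - n + a + 1)) =
      hypWeight A B n a * ((A - a) * (n - a)) := by
  obtain ⟨b, rfl⟩ : ∃ b, n = a + b + 1 := ⟨n - a - 1, by omega⟩
  have h1 := Nat.choose_succ_right_eq A a
  have h2 := Nat.choose_succ_right_eq B b
  have e1 : a + b + 1 - (a + 1) = b := by omega
  have e2 : a + b + 1 - a = b + 1 := by omega
  rw [hypWeight, hypWeight, e1, e2]
  have hb : b ≤ B := by omega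
  have h1' : (A.choose (a + 1) : ℝ) * (a + 1) = A.choose a * (A - a) := by
    rw [← Nat.cast_sub hA]; exact_mod_cast h1
  have h2' : (B.choose (b + 1) : ℝ) * (b + 1) = B.choose b * (B - b) := by
    rw [← Nat.cast_sub hb]; exact_mod_cast h2
  push_cast
  linear_combination (B.choose b : ℝ) * (B - b) * h1' - (A.choose a : ℝ) * (A - a) * h2'

theorem log_hypWeight_succ {A B n a : ℕ} {q r : ℝ} (hA : (A : ℝ) = n + q) (hB : (B : ℝ) = n - q)
    (hr : r ≤ 1 / 2) (ha : a < n)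
    (h1 : |2 * q - (2 * a - n)| ≤ r * n) (h2 : |(2 * a - n : ℝ)| ≤ r * n)
    (h3 : |(2 * a - n + 2 : ℝ)| ≤ r * n) (h4 : |2 * a - n + 2 - 2 * q| ≤ r * n)
    (hpos : 0 < hypWeight A B n a) :
    0 < hypWeight A B n (a + 1) ∧
      |Real.log (hypWeight A B n (a + 1)) - Real.log (hypWeight A B n a) -
        (4 * q - 4 * (2 * a - n) - 4) / n| ≤ 8 * r ^ 2 := by
  have hn : (0 : ℝ) < n := by exact_mod_cast (by omega : 0 < n)
  have key : ∀ y : ℝ, |y| ≤ r * n → 1 / 2 ≤ 1 + y / n ∧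
      |Real.log (1 + y / n) - y / n| ≤ 2 * r ^ 2 := by
    intro y hy
    have := abs_log_sub_le (u := 1 + y / n) hr
      (by rw [add_sub_cancel_left, abs_div, abs_of_pos hn, div_le_iff₀ hn]; exact hy)
    rwa [add_sub_cancel_left] at this
  obtain ⟨p1, l1⟩ := key _ h1
  obtain ⟨p2, l2⟩ := key (-(2 * a - n)) (by rwa [abs_neg])
  obtain ⟨p3, l3⟩ := key _ h3
  obtain ⟨p4, l4⟩ := key _ h4
  set u1 := 1 + (2 * q - (2 * a - n)) / n with hu1
  set u2 := 1 + -(2 * a - n : ℝ) / n with hu2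
  set u3 := 1 + (2 * a - n + 2 : ℝ) / n with hu3
  set u4 := 1 + (2 * a - n + 2 - 2 * q) / n with hu4
  have e1 : (A - a : ℝ) = n / 2 * u1 := by rw [hu1, hA]; field_simp; ring
  have e2 : (n - a : ℝ) = n / 2 * u2 := by rw [hu2]; field_simp; ring
  have e3 : (a + 1 : ℝ) = n / 2 * u3 := by rw [hu3]; field_simp; ring
  have e4 : (B - n + a + 1 : ℝ) = n / 2 * u4 := by rw [hu4, hB]; field_simp; ring
  have q1 : 0 < u1 := by linarith
  have q2 : 0 < u2 := by linarith
  have q3 : 0 < u3 := by linarith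
  have q4 : 0 < u4 := by linarith
  have hAa : a ≤ A := by
    have : (0 : ℝ) < n / 2 * u1 := by positivity
    exact_mod_cast (by linarith : (a : ℝ) ≤ A)
  have hBa : n ≤ B + a + 1 := by
    have : (0 : ℝ) < n / 2 * u4 := by positivity
    exact_mod_cast (by linarith : (n : ℝ) ≤ B + a + 1)
  have hs := hypWeight_succ ha hAa hBa
  rw [e1, e2, e3, e4] at hs
  have hs' : hypWeight A B n (a + 1) = hypWeight A B n a * (u1 * u2 / (u3 * u4)) := by
    have : hypWeight A B n (a + 1) * (u3 * u4) = hypWeight A B n a * (u1 * u2) := by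
      have hn2 : ((n : ℝ) / 2) ^ 2 ≠ 0 := by positivity
      apply mul_left_cancel₀ hn2
      linear_combination hs
    rw [← mul_div_assoc, eq_div_iff (by positivity), this]
  refine ⟨by rw [hs']; positivity, ?_⟩
  rw [hs', Real.log_mul hpos.ne' (by positivity), Real.log_div (by positivity) (by positivity),
    Real.log_mul q1.ne' q2.ne', Real.log_mul q3.ne' q4.ne']
  have e : (4 * q - 4 * (2 * a - n) - 4) / (n : ℝ) = (2 * q - (2 * a - n)) / n +
      -(2 * a - n : ℝ) / n - (2 * a - n + 2 : ℝ) / n - (2 * a - n + 2 - 2 * q) / n := by ring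
  rw [e]
  rw [abs_le] at *
  constructor <;> linarith

theorem log_hypWeight_add {A B n : ℕ} {q r L : ℝ} (hA : (A : ℝ) = n + q) (hB : (B : ℝ) = n - q)
    (hr : r ≤ 1 / 2) (hL : 3 * L ≤ r * n) (hq : |2 * q| ≤ L) {a : ℕ}
    (ha : |(2 * a - n : ℝ)| ≤ 2 * L) (hpos : 0 < hypWeight A B n a) (m : ℕ) (hm : a + m ≤ n)
    (ham : |(2 * (a + m : ℕ) - n : ℝ)| ≤ 2 * L) :
    0 < hypWeight A B n (a + m) ∧
      |Real.log (hypWeight A B n (a + m)) - Real.log (hypWeight A B n a) -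
        ((2 * a - n - q) ^ 2 - (2 * (a + m : ℕ) - n - q) ^ 2) / n| ≤ m * (8 * r ^ 2) := by
  induction m with
  | zero => simpa using hpos
  | succ m ih =>
    have hm0 : (0 : ℝ) ≤ m := m.cast_nonneg
    push_cast at ham
    rw [abs_le] at ha ham hq
    have hbd : |(2 * (a + m : ℕ) - n : ℝ)| ≤ 2 * L := by
      push_cast; rw [abs_le]; constructor <;> linarith
    obtain ⟨i1, i2⟩ := ih (by omega) hbd
    push_cast at hbd
    rw [abs_le] at hbd
    obtain ⟨j1, j2⟩ := log_hypWeight_succ (a := a + m) hA hB hr (by omega)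
      (by push_cast; rw [abs_le]; constructor <;> linarith)
      (by push_cast; rw [abs_le]; constructor <;> linarith)
      (by push_cast; rw [abs_le]; constructor <;> linarith)
      (by push_cast; rw [abs_le]; constructor <;> linarith) i1
    refine ⟨j1, ?_⟩
    have e : ((2 * a - n - q) ^ 2 - (2 * (a + (m + 1) : ℕ) - n - q) ^ 2) / (n : ℝ) =
      ((2 * a - n - q) ^ 2 - (2 * (a + m : ℕ) - n - q) ^ 2) / n +
        (4 * q - 4 * (2 * (a + m : ℕ) - n) - 4) / n := by
      push_cast; ring
    rw [e, ← add_assoc a m 1]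
    push_cast at *
    rw [abs_le] at *
    constructor <;> linarith

theorem abs_log_hypWeight_sub_le {A B n : ℕ} {q r L : ℝ} (hA : (A : ℝ) = n + q)
    (hB : (B : ℝ) = n - q) (hr : r ≤ 1 / 2) (hL : 3 * L ≤ r * n) (hq : |2 * q| ≤ L) {a b : ℕ}
    (ha : |(2 * a - n : ℝ)| ≤ 2 * L) (hb : |(2 * b - n : ℝ)| ≤ 2 * L) (han : a ≤ n) (hbn : b ≤ n)
    (hpa : 0 < hypWeight A B n a) (hpb : 0 < hypWeight A B n b) :
    |Real.log (hypWeight A B n b) - Real.log (hypWeight A B n a) -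
        ((2 * a - n - q) ^ 2 - (2 * b - n - q) ^ 2) / n| ≤ |(b : ℝ) - a| * (8 * r ^ 2) := by
  wlog hab : a ≤ b generalizing a b
  · have h := this hb ha hbn han hpb hpa (by omega)
    rw [abs_sub_comm (b : ℝ) a, ← abs_neg]
    convert h using 2
    ring
  · obtain ⟨m, rfl⟩ := Nat.exists_eq_add_of_le hab
    have h := (log_hypWeight_add hA hB hr hL hq ha hpa m hbn hb).2
    convert h using 2
    push_cast
    rw [add_sub_cancel_left, Nat.abs_cast]

theorem eventually_logb_small (ε : ℝ) (hε : 0 < ε) :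
    ∃ N : ℕ, ∀ n : ℕ, N ≤ n → Real.logb 2 n ≤ ε * n ∧
      Real.logb 2 n ^ ((3 : ℝ) / 2) / Real.sqrt n ≤ ε := by
  have h1 : Filter.Tendsto (fun n : ℕ => Real.logb 2 n / n) Filter.atTop (nhds 0) := by
    have h := (Real.isLittleO_log_id_atTop.tendsto_div_nhds_zero.comp
      tendsto_natCast_atTop_atTop (α := ℕ)).div_const (Real.log 2)
    rw [zero_div] at h
    refine h.congr fun n => ?_
    simp only [Function.comp, id, Real.logb]
    ring
  have h2 : Filter.Tendsto (fun n : ℕ => Real.logb 2 n ^ ((3 : ℝ) / 2) / Real.sqrt n)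
      Filter.atTop (nhds 0) := by
    have h := ((isLittleO_log_rpow_rpow_atTop (3 / 2 : ℝ)
      (by norm_num : (0 : ℝ) < 1 / 2)).tendsto_div_nhds_zero.comp
      tendsto_natCast_atTop_atTop (α := ℕ)).div_const (Real.log 2 ^ (3 / 2 : ℝ))
    rw [zero_div] at h
    refine h.congr fun n => ?_
    simp only [Function.comp, Real.logb]
    rw [Real.div_rpow (Real.log_natCast_nonneg n) (Real.log_nonneg (by norm_num)),
      Real.sqrt_eq_rpow]
    ring
  obtain ⟨N, hN⟩ := Filter.eventually_atTop.1
    ((h1.eventually_le_const hε).and ((h2.eventually_le_const hε).and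
      (Filter.eventually_gt_atTop 0)))
  refine ⟨N, fun n hn => ⟨?_, (hN n hn).2.1⟩⟩
  have hn0 : (0 : ℝ) < n := by exact_mod_cast (hN n hn).2.2
  exact (div_le_iff₀ hn0).1 (hN n hn).1

theorem hypWeight_ratio_large {c : ℝ} (hc : 0 < c) : ∃ N : ℕ, ∀ n : ℕ, N ≤ n → 1 ≤ n →
    ∀ q : ℤ, ∀ a b : ℕ, a ≤ n → b ≤ n →
    0 < hypWeight (n + q).toNat (n - q).toNat n a → 0 < hypWeight (n + q).toNat (n - q).toNat n b →
    ∀ L : ℝ, L = c * Real.sqrt (n * Real.logb 2 n) → |2 * (q : ℝ)| ≤ L →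
    |(2 * a - n : ℝ)| ≤ 2 * L → |(2 * b - n : ℝ)| ≤ 2 * L → |(b : ℝ) - a| ≤ L →
    |hypWeight (n + q).toNat (n - q).toNat n b / hypWeight (n + q).toNat (n - q).toNat n a -
      Real.exp (((2 * a - n - q) ^ 2 - (2 * b - n - q) ^ 2) / n)| ≤
      144 * c ^ 3 * (Real.logb 2 n ^ ((3 : ℝ) / 2) / Real.sqrt n) *
        Real.exp (((2 * a - n - q) ^ 2 - (2 * b - n - q) ^ 2) / n) := by
  obtain ⟨N, hN⟩ := eventually_logb_small (min (1 / (36 * c ^ 2)) (1 / (72 * c ^ 3)))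
    (by positivity)
  refine ⟨N, fun n hn hn1 q a b han hbn hpa hpb L hL hq ha hb hab => ?_⟩
  obtain ⟨s1, s2⟩ := hN n hn
  have hn0 : (0 : ℝ) < n := by exact_mod_cast hn1
  have hl0 : 0 ≤ Real.logb 2 n := Real.logb_nonneg (by norm_num) (by exact_mod_cast hn1)
  set l := Real.logb 2 n with hl
  have hL0 : 0 ≤ L := by rw [hL]; positivity
  have hL2 : L ^ 2 = c ^ 2 * (n * l) := by
    rw [hL, mul_pow, Real.sq_sqrt (by positivity)]
  have hL3 : L ^ 3 / n ^ 2 = c ^ 3 * (l ^ ((3 : ℝ) / 2) / Real.sqrt n) := by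
    have hs : 0 < Real.sqrt n := Real.sqrt_pos.2 hn0
    have e : l ^ ((3 : ℝ) / 2) = l * Real.sqrt l := by
      rw [show (3 : ℝ) / 2 = 1 + 1 / 2 by norm_num,
        Real.rpow_add_of_nonneg hl0 (by norm_num) (by norm_num), Real.rpow_one, Real.sqrt_eq_rpow]
    rw [e, pow_succ, hL2, hL, Real.sqrt_mul hn0.le]
    have hss : (n : ℝ) = Real.sqrt n ^ 2 := (Real.sq_sqrt hn0.le).symm
    field_simp
    rw [← hss]
    ring
  have h6 : 6 * L ≤ n := by
    have : l ≤ 1 / (36 * c ^ 2) * n := s1.trans (by gcongr; exact min_le_left _ _)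
    have h : (6 * L) ^ 2 ≤ (n : ℝ) ^ 2 := by
      calc (6 * L) ^ 2 = 36 * c ^ 2 * n * l := by rw [mul_pow, hL2]; ring
        _ ≤ 36 * c ^ 2 * n * (1 / (36 * c ^ 2) * n) := by gcongr
        _ = n ^ 2 := by field_simp
    exact (pow_le_pow_iff_left₀ (by positivity) hn0.le two_ne_zero).1 h
  rw [abs_le] at hq
  have hA : (((n + q).toNat : ℕ) : ℝ) = n + q := by
    have : (0 : ℤ) ≤ n + q := by exact_mod_cast (by linarith : (0 : ℝ) ≤ n + q)
    exact_mod_cast Int.toNat_of_nonneg this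
  have hB : (((n - q).toNat : ℕ) : ℝ) = n - q := by
    have : (0 : ℤ) ≤ n - q := by exact_mod_cast (by linarith : (0 : ℝ) ≤ n - q)
    exact_mod_cast Int.toNat_of_nonneg this
  rw [← abs_le] at hq
  have hr : 3 * L / n ≤ 1 / 2 := by rw [div_le_iff₀ hn0]; linarith
  have key := abs_log_hypWeight_sub_le hA hB hr (by rw [div_mul_cancel₀ _ hn0.ne']) hq ha hb
    han hbn hpa hpb
  set wa := hypWeight (n + q).toNat (n - q).toNat n a
  set wb := hypWeight (n + q).toNat (n - q).toNat n b
  set e := ((2 * a - n - q) ^ 2 - (2 * b - n - q) ^ 2) / (n : ℝ)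
  set D := l ^ ((3 : ℝ) / 2) / Real.sqrt n
  set δ := Real.log wb - Real.log wa - e with hδ
  have hδD : |δ| ≤ 72 * c ^ 3 * D := by
    calc |δ| ≤ |(b : ℝ) - a| * (8 * (3 * L / n) ^ 2) := key
      _ ≤ L * (8 * (3 * L / n) ^ 2) := by gcongr
      _ = 72 * (L ^ 3 / n ^ 2) := by field_simp; ring
      _ = 72 * c ^ 3 * D := by rw [hL3]; ring
  have hδ1 : |δ| ≤ 1 := by
    refine hδD.trans ?_
    calc 72 * c ^ 3 * D ≤ 72 * c ^ 3 * (1 / (72 * c ^ 3)) := by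
          gcongr; exact s2.trans (min_le_right _ _)
      _ = 1 := by field_simp
  have hw : wb / wa = Real.exp e * Real.exp δ := by
    rw [← Real.exp_add, hδ, add_sub_cancel, Real.exp_sub, Real.exp_log hpb, Real.exp_log hpa]
  have : wb / wa - Real.exp e = Real.exp e * (Real.exp δ - 1) := by rw [hw]; ring
  rw [this, abs_mul, abs_of_pos (Real.exp_pos e), mul_comm]
  gcongr
  calc |Real.exp δ - 1| ≤ 2 * |δ| := Real.abs_exp_sub_one_le hδ1
    _ ≤ 144 * c ^ 3 * D := by linarith

theorem hypWeight_ratio_small {c : ℝ} (hc : 0 < c) (N : ℕ) : ∃ K : ℝ, 0 < K ∧ ∀ n : ℕ, n < N →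
    2 ≤ n → ∀ q : ℤ, ∀ a b : ℕ,
    0 < hypWeight (n + q).toNat (n - q).toNat n a →
    ∀ L : ℝ, L = c * Real.sqrt (n * Real.logb 2 n) → |2 * (q : ℝ)| ≤ L →
    |(2 * a - n : ℝ)| ≤ 2 * L → |(2 * b - n : ℝ)| ≤ 2 * L →
    |hypWeight (n + q).toNat (n - q).toNat n b / hypWeight (n + q).toNat (n - q).toNat n a -
      Real.exp (((2 * a - n - q) ^ 2 - (2 * b - n - q) ^ 2) / n)| ≤
      K * (Real.logb 2 n ^ ((3 : ℝ) / 2) / Real.sqrt n) *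
        Real.exp (((2 * a - n - q) ^ 2 - (2 * b - n - q) ^ 2) / n) := by
  obtain ⟨C, hC⟩ := exists_nat_ge c
  refine ⟨N * (2 ^ (2 * (N + C * N)) * Real.exp (9 * c ^ 2 * N) + 1) + 1, by positivity, ?_⟩
  intro n hnN hn2 q a b hpa L hL hq ha hb
  have hn0 : (0 : ℝ) < n := by exact_mod_cast (by omega : 0 < n)
  have hn1 : (1 : ℝ) ≤ n := by exact_mod_cast (by omega : 1 ≤ n)
  have hnN' : (n : ℝ) ≤ N := by exact_mod_cast hnN.le
  have hl1 : 1 ≤ Real.logb 2 n := by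
    rw [Real.le_logb_iff_rpow_le (by norm_num) hn0, Real.rpow_one]; exact_mod_cast hn2
  have hln : Real.logb 2 n ≤ n := by
    rw [Real.logb_le_iff_le_rpow (by norm_num) hn0, Real.rpow_natCast]
    exact_mod_cast Nat.lt_two_pow_self.le
  set l := Real.logb 2 n
  have hL0 : 0 ≤ L := by rw [hL]; positivity
  have hL2 : L ^ 2 = c ^ 2 * (n * l) := by
    rw [hL, mul_pow, Real.sq_sqrt (by positivity)]
  have hLn : L ≤ C * n := by
    rw [hL]
    gcongr
    rw [Real.sqrt_le_left hn0.le]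
    nlinarith
  have hqC : |q| ≤ C * n := by
    have : |(q : ℝ)| ≤ C * n := by
      rw [abs_mul, abs_two] at hq
      linarith [abs_nonneg (q : ℝ)]
    exact_mod_cast this
  have hCN : C * n ≤ C * N := Nat.mul_le_mul_left C hnN.le
  have hAB : (n + q).toNat + (n - q).toNat ≤ 2 * (N + C * N) := by
    rw [abs_le] at hqC
    zify at hCN
    generalize (C : ℤ) * n = z at *
    have : ((C * N : ℕ) : ℤ) = C * N := by push_cast; ring
    generalize (C * N) = w at *
    omega
  have hb4 : hypWeight (n + q).toNat (n - q).toNat n b ≤ 2 ^ (2 * (N + C * N)) :=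
    (hypWeight_le _ _ _ _).trans (pow_le_pow_right₀ (by norm_num) hAB)
  have ha1 := one_le_hypWeight_of_pos hpa
  have hb0 := hypWeight_nonneg (n + q).toNat (n - q).toNat n b
  set wa := hypWeight (n + q).toNat (n - q).toNat n a
  set wb := hypWeight (n + q).toNat (n - q).toNat n b
  set e := ((2 * a - n - q) ^ 2 - (2 * b - n - q) ^ 2) / (n : ℝ) with he
  have hratio : wb / wa ≤ 2 ^ (2 * (N + C * N)) := (div_le_self hb0 ha1).trans hb4
  have hen : -e ≤ 9 * c ^ 2 * N := by
    have h1 : (2 * b - n - q : ℝ) ^ 2 ≤ (3 * L) ^ 2 := by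
      rw [abs_le] at hb hq
      apply sq_le_sq' <;> linarith
    have h2 : -e ≤ 9 * L ^ 2 / n := by
      rw [he, ← neg_div]
      gcongr
      nlinarith [sq_nonneg (2 * a - n - q : ℝ)]
    calc -e ≤ 9 * L ^ 2 / n := h2
      _ = 9 * c ^ 2 * l := by rw [hL2]; field_simp
      _ ≤ 9 * c ^ 2 * N := by gcongr; exact hln.trans hnN'
  have h1 : 1 ≤ Real.exp (9 * c ^ 2 * N) * Real.exp e := by
    rw [← Real.exp_add]
    exact Real.one_le_exp (by linarith)
  have hD : 1 ≤ N * (l ^ ((3 : ℝ) / 2) / Real.sqrt n) := by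
    have h3 : 1 ≤ l ^ ((3 : ℝ) / 2) := Real.one_le_rpow hl1 (by norm_num)
    have h4 : Real.sqrt n ≤ N := (Real.sqrt_le_left (by positivity)).2 (by nlinarith)
    have hs : 0 < Real.sqrt n := Real.sqrt_pos.2 hn0
    rw [← mul_div_assoc, le_div_iff₀ hs]
    nlinarith [hs]
  have hD0 : 0 ≤ l ^ ((3 : ℝ) / 2) / Real.sqrt n := by positivity
  set D := l ^ ((3 : ℝ) / 2) / Real.sqrt n
  have hE := Real.exp_pos e
  calc |wb / wa - Real.exp e| ≤ wb / wa + Real.exp e := by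
        rw [abs_le]
        have : 0 ≤ wb / wa := by positivity
        constructor <;> linarith
    _ ≤ 2 ^ (2 * (N + C * N)) * (Real.exp (9 * c ^ 2 * N) * Real.exp e) + Real.exp e := by
        gcongr
        exact hratio.trans (le_mul_of_one_le_right (by positivity) h1)
    _ = 1 * ((2 ^ (2 * (N + C * N)) * Real.exp (9 * c ^ 2 * N) + 1) * Real.exp e) := by ring
    _ ≤ (N * D) * ((2 ^ (2 * (N + C * N)) * Real.exp (9 * c ^ 2 * N) + 1) * Real.exp e) := by
        gcongr
    _ ≤ _ := by
        have : 0 ≤ D * Real.exp e := by positivity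
        linarith

theorem exists_hypPMF_ratio_bound {c : ℝ} (hc : 0 < c) :
    ∃ K : ℝ, 0 < K ∧ ∀ n : ℕ, 1 ≤ n → ∀ p t x x' : ℤ, p % 2 = 0 →
        0 < hypPMF (2 * n) p n (t - x) → 0 < hypPMF (2 * n) p n (t - x') →
        |(p : ℝ)| ≤ c * Real.sqrt (n * Real.logb 2 n) →
        |(t : ℝ)| ≤ c * Real.sqrt (n * Real.logb 2 n) →
        |(x : ℝ)| ≤ c * Real.sqrt (n * Real.logb 2 n) →
        |(x' : ℝ)| ≤ c * Real.sqrt (n * Real.logb 2 n) →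
        |hypPMF (2 * n) p n (t - x') / hypPMF (2 * n) p n (t - x) -
            Real.exp ((-2 * ((t : ℝ) - (p : ℝ) / 2) * (x : ℝ) + (x : ℝ) ^ 2 +
              2 * ((t : ℝ) - (p : ℝ) / 2) * (x' : ℝ) - (x' : ℝ) ^ 2) / n)| ≤
          K * (Real.logb 2 n ^ ((3 : ℝ) / 2) / Real.sqrt n) *
            Real.exp ((-2 * ((t : ℝ) - (p : ℝ) / 2) * (x : ℝ) + (x : ℝ) ^ 2 +
              2 * ((t : ℝ) - (p : ℝ) / 2) * (x' : ℝ) - (x' : ℝ) ^ 2) / n) := by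
  obtain ⟨N, hN⟩ := hypWeight_ratio_large hc
  obtain ⟨K, hK0, hK⟩ := hypWeight_ratio_small hc N
  refine ⟨max K (144 * c ^ 3), by positivity, ?_⟩
  intro n hn p t x x' hp hpx hpx' bp bt bx bx'
  obtain ⟨q, rfl⟩ : ∃ q, p = 2 * q := ⟨p / 2, by omega⟩
  rcases hn.eq_or_lt with rfl | hn2
  · simp only [Nat.cast_one, Real.logb_one, mul_zero, Real.sqrt_zero] at bx bx'
    have h1 : x = 0 := by simpa using bx
    have h2 : x' = 0 := by simpa using bx'
    subst h1 h2
    rw [div_self hpx.ne']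
    simp
  obtain ⟨a, han, hka, ea⟩ := exists_hypWeight_of_hypPMF_pos hpx
  obtain ⟨b, hbn, hkb, eb⟩ := exists_hypWeight_of_hypPMF_pos hpx'
  have hch : (0 : ℝ) < (2 * n).choose n := by exact_mod_cast Nat.choose_pos (by omega)
  rw [ea] at hpx
  rw [eb] at hpx'
  have hpa := (div_pos_iff_of_pos_right hch).1 hpx
  have hpb := (div_pos_iff_of_pos_right hch).1 hpx'
  rw [ea, eb, div_div_div_cancel_right₀ hch.ne']
  have ra : (t - x : ℝ) = 2 * a - n := by exact_mod_cast hka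
  have rb : (t - x' : ℝ) = 2 * b - n := by exact_mod_cast hkb
  have hexp : (-2 * ((t : ℝ) - ((2 * q : ℤ) : ℝ) / 2) * (x : ℝ) + (x : ℝ) ^ 2 +
      2 * ((t : ℝ) - ((2 * q : ℤ) : ℝ) / 2) * (x' : ℝ) - (x' : ℝ) ^ 2) / n =
      ((2 * a - n - q) ^ 2 - (2 * b - n - q) ^ 2) / n := by
    rw [← ra, ← rb]; push_cast; ring
  rw [hexp]
  push_cast at bp
  generalize hL : c * Real.sqrt (n * Real.logb 2 n) = L at *
  have b1 : |(2 * a - n : ℝ)| ≤ 2 * L := by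
    rw [← ra, abs_le]; rw [abs_le] at bt bx; constructor <;> linarith
  have b2 : |(2 * b - n : ℝ)| ≤ 2 * L := by
    rw [← rb, abs_le]; rw [abs_le] at bt bx'; constructor <;> linarith
  have b3 : |(b - a : ℝ)| ≤ L := by
    rw [abs_le] at *; constructor <;> linarith
  have hl0 : 0 ≤ Real.logb 2 n := Real.logb_nonneg (by norm_num) (by exact_mod_cast hn)
  rcases lt_or_ge n N with h | h
  · refine (hK n h hn2 q a b hpa L hL.symm bp b1 b2).trans ?_
    gcongr
    exact le_max_left _ _
  · refine (hN n h hn q a b han hbn hpa hpb L hL.symm bp b1 b2 b3).trans ?_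
    gcongr
    exact le_max_right _ _

theorem stmt_13 :
    ∃ φ : ℝ → ℝ, (∀ c : ℝ, 0 < c → 0 < φ c) ∧
      ∀ c : ℝ, 0 < c → ∀ n : ℕ, 1 ≤ n → ∀ p t x x' : ℤ, p % 2 = 0 →
        0 < hypPMF (2 * n) p n (t - x) → 0 < hypPMF (2 * n) p n (t - x') →
        |(p : ℝ)| ≤ c * Real.sqrt (n * Real.logb 2 n) →
        |(t : ℝ)| ≤ c * Real.sqrt (n * Real.logb 2 n) →
        |(x : ℝ)| ≤ c * Real.sqrt (n * Real.logb 2 n) →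
        |(x' : ℝ)| ≤ c * Real.sqrt (n * Real.logb 2 n) →
        |hypPMF (2 * n) p n (t - x') / hypPMF (2 * n) p n (t - x) -
            Real.exp ((-2 * ((t : ℝ) - (p : ℝ) / 2) * (x : ℝ) + (x : ℝ) ^ 2 +
              2 * ((t : ℝ) - (p : ℝ) / 2) * (x' : ℝ) - (x' : ℝ) ^ 2) / n)| ≤
          φ c * (Real.logb 2 n ^ ((3 : ℝ) / 2) / Real.sqrt n) *
            Real.exp ((-2 * ((t : ℝ) - (p : ℝ) / 2) * (x : ℝ) + (x : ℝ) ^ 2 +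
              2 * ((t : ℝ) - (p : ℝ) / 2) * (x' : ℝ) - (x' : ℝ) ^ 2) / n) := by
  choose! φ hφ using fun c (hc : 0 < c) => exists_hypPMF_ratio_bound hc
  exact ⟨φ, fun c hc => (hφ c hc).1, fun c hc => (hφ c hc).2⟩
end

section
/- There exists m₀ ∈ ℕ such that for every m ≥ m₀, every integer i with m/2 ≤ i ≤ m, and every ε ∈ [-1,1] with |ε| ≤ 4·√(log m / s_1), it holds that Pr_{y←B(s_1 − s_i, ε)}[|y + ε·s_i| ≤ 4·√(log m · s_i)] ≤ 12·ℓ_i·√(log m)/m. -/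
def lRound (m i : ℕ) : ℕ := m + 1 - i

def sRound (m i : ℕ) : ℕ := ∑ j ∈ Finset.Icc i m, lRound m j

theorem sRound_add (d i : ℕ) : 2 * sRound (i + d) i = (d + 1) * (d + 2) := by
  induction d generalizing i with
  | zero => simp [sRound, lRound]
  | succ d ih =>
    have h := ih (i + 1)
    have e : i + 1 + d = i + (d + 1) := by ring
    have hI : Finset.Icc i (i + (d + 1)) = insert i (Finset.Icc (i + 1) (i + (d + 1))) := by
      ext x
      simp only [Finset.mem_Icc, Finset.mem_insert]
      omega
    rw [e] at h
    unfold sRound at h ⊢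
    rw [hI, Finset.sum_insert (by simp), mul_add, h]
    have : lRound (i + (d + 1)) i = d + 2 := by unfold lRound; omega
    rw [this]
    ring

theorem two_mul_sRound {m i : ℕ} (h : i ≤ m) :
    2 * (sRound m i : ℝ) = lRound m i * (lRound m i + 1) := by
  obtain ⟨d, rfl⟩ := Nat.exists_eq_add_of_le h
  have h1 := sRound_add d i
  have h2 : lRound (i + d) i = d + 1 := by unfold lRound; omega
  rw [h2]
  exact_mod_cast h1

theorem factorial_eq_stirlingSeq_mul {n : ℕ} (hn : n ≠ 0) :
    (n.factorial : ℝ) =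
      Stirling.stirlingSeq n * (Real.sqrt (2 * n) * (n / Real.exp 1) ^ n) := by
  have : (0 : ℝ) < n := by exact_mod_cast Nat.pos_of_ne_zero hn
  unfold Stirling.stirlingSeq
  field_simp

theorem pow_mul_pow_le_of_add_eq_one {a b : ℕ} (ha : 0 < a) (hb : 0 < b) {p q : ℝ}
    (hp : 0 ≤ p) (hq : 0 ≤ q) (hpq : p + q = 1) :
    p ^ a * q ^ b * ((a + b : ℕ) : ℝ) ^ (a + b) ≤ (a : ℝ) ^ a * (b : ℝ) ^ b := by
  have ha' : (0 : ℝ) < a := by exact_mod_cast ha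
  have hb' : (0 : ℝ) < b := by exact_mod_cast hb
  have bound : ∀ (c : ℕ) (x : ℝ), 0 ≤ x → x ^ c ≤ Real.exp (c * (x - 1)) := by
    intro c x hx
    rw [Real.exp_nat_mul]
    exact pow_le_pow_left₀ hx (by linarith [Real.add_one_le_exp (x - 1)]) c
  set n : ℝ := ((a + b : ℕ) : ℝ) with hn
  have hn' : n = a + b := by rw [hn]; push_cast; ring
  have hn0 : 0 < n := by rw [hn']; positivity
  have h : (p * n / a) ^ a * (q * n / b) ^ b ≤ 1 := by
    calc (p * n / a) ^ a * (q * n / b) ^ b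
        ≤ Real.exp (a * (p * n / a - 1)) * Real.exp (b * (q * n / b - 1)) :=
          mul_le_mul (bound _ _ (by positivity)) (bound _ _ (by positivity))
            (by positivity) (by positivity)
      _ = Real.exp (n * (p + q) - (a + b)) := by
          rw [← Real.exp_add]
          congr 1
          field_simp
          ring
      _ = 1 := by rw [hpq, hn']; simp
  rw [div_pow, div_pow, div_mul_div_comm, div_le_one (by positivity)] at h
  calc p ^ a * q ^ b * n ^ (a + b) = (p * n) ^ a * (q * n) ^ b := by
        rw [mul_pow, mul_pow, pow_add]; ring
    _ ≤ _ := h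

theorem choose_mul_pow_mul_pow_le {a b : ℕ} (ha : 0 < a) (hb : 0 < b) {p q : ℝ}
    (hp : 0 ≤ p) (hq : 0 ≤ q) (hpq : p + q = 1) :
    ((a + b).choose a : ℝ) * p ^ a * q ^ b ≤
      Real.sqrt (((a + b : ℕ) : ℝ) / (2 * Real.pi * a * b)) := by
  have ha' : (0 : ℝ) < a := by exact_mod_cast ha
  have hb' : (0 : ℝ) < b := by exact_mod_cast hb
  have hmle := pow_mul_pow_le_of_add_eq_one ha hb hp hq hpq
  have hfact : ((a + b).choose a : ℝ) * a.factorial * b.factorial = (a + b).factorial := by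
    have := Nat.choose_mul_factorial_mul_factorial (Nat.le_add_right a b)
    rw [Nat.add_sub_cancel_left] at this
    exact_mod_cast this
  have hanti : Stirling.stirlingSeq (a + b) ≤ Stirling.stirlingSeq a := by
    obtain ⟨c, rfl⟩ := Nat.exists_eq_succ_of_ne_zero ha.ne'
    have := Stirling.stirlingSeq'_antitone (Nat.le_add_right c b)
    simpa [Function.comp, Nat.succ_eq_add_one, add_right_comm] using this
  have hA : Real.sqrt Real.pi ≤ Stirling.stirlingSeq a := Stirling.sqrt_pi_le_stirlingSeq ha.ne'
  have hB : Real.sqrt Real.pi ≤ Stirling.stirlingSeq b := Stirling.sqrt_pi_le_stirlingSeq hb.ne'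
  have hpi : 0 < Real.sqrt Real.pi := Real.sqrt_pos.2 Real.pi_pos
  rw [factorial_eq_stirlingSeq_mul ha.ne', factorial_eq_stirlingSeq_mul hb.ne',
    factorial_eq_stirlingSeq_mul (by omega : a + b ≠ 0)] at hfact
  set n : ℝ := ((a + b : ℕ) : ℝ) with hn
  have hn0 : 0 < n := by rw [hn]; push_cast; positivity
  set A := Stirling.stirlingSeq a
  set B := Stirling.stirlingSeq b
  set C := ((a + b).choose a : ℝ)
  have hA0 : 0 < A := hpi.trans_le hA
  have hB0 : 0 < B := hpi.trans_le hB
  have hC0 : 0 ≤ C := Nat.cast_nonneg _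
  have e1 : C * (a : ℝ) ^ a * (b : ℝ) ^ b * B * (Real.sqrt (2 * a) * Real.sqrt (2 * b)) ≤
      Real.sqrt (2 * n) * n ^ (a + b) := by
    have hE : (0 : ℝ) < Real.exp 1 ^ (a + b) := by positivity
    have h2 : A * (C * (a : ℝ) ^ a * (b : ℝ) ^ b * B * (Real.sqrt (2 * a) * Real.sqrt (2 * b))) =
        Stirling.stirlingSeq (a + b) * (Real.sqrt (2 * n) * n ^ (a + b)) := by
      rw [div_pow, div_pow, div_pow, pow_add (Real.exp 1)] at hfact
      field_simp at hfact
      linarith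
    have h3 : A * (C * (a : ℝ) ^ a * (b : ℝ) ^ b * B * (Real.sqrt (2 * a) * Real.sqrt (2 * b))) ≤
        A * (Real.sqrt (2 * n) * n ^ (a + b)) := by
      rw [h2]
      exact mul_le_mul_of_nonneg_right hanti (by positivity)
    exact le_of_mul_le_mul_left h3 hA0
  have e2 : C * p ^ a * q ^ b * (B * (Real.sqrt (2 * a) * Real.sqrt (2 * b))) ≤
      Real.sqrt (2 * n) := by
    have hN : 0 < n ^ (a + b) := by positivity
    refine le_of_mul_le_mul_right ?_ hN
    refine le_trans ?_ e1
    have := mul_le_mul_of_nonneg_left hmle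
      (by positivity : 0 ≤ C * (B * (Real.sqrt (2 * a) * Real.sqrt (2 * b))))
    linarith
  have e3 : C * p ^ a * q ^ b * (Real.sqrt Real.pi * (Real.sqrt (2 * a) * Real.sqrt (2 * b))) ≤
      Real.sqrt (2 * n) := by
    refine le_trans ?_ e2
    gcongr
  rw [← le_div_iff₀ (by positivity), ← Real.sqrt_mul (by positivity),
    ← Real.sqrt_mul (by positivity), ← Real.sqrt_div (by positivity)] at e3
  refine e3.trans_eq (congrArg Real.sqrt ?_)
  field_simp

theorem binPMF_le {n : ℕ} (hn : 0 < n) {ε : ℝ} (hε : ε ∈ Set.Icc (-1 : ℝ) 1) {z : ℤ}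
    (hz : |(z : ℝ)| ≤ n / 2) : binPMF n ε z ≤ 1 / Real.sqrt n := by
  unfold binPMF
  split_ifs with h
  · obtain ⟨h1, h2, h3⟩ := h
    have hn' : (0 : ℝ) < n := by exact_mod_cast hn
    obtain ⟨a, ha⟩ := Int.eq_ofNat_of_zero_le (by omega : 0 ≤ ((n : ℤ) + z) / 2)
    obtain ⟨b, hb⟩ := Int.eq_ofNat_of_zero_le (by omega : 0 ≤ ((n : ℤ) - z) / 2)
    have hab : n = a + b := by omega
    have hzab : z = (a : ℤ) - b := by omega
    rw [ha, hb, Int.toNat_natCast, Int.toNat_natCast]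
    have hnr : (n : ℝ) = a + b := by exact_mod_cast hab
    have hzr : (z : ℝ) = a - b := by exact_mod_cast hzab
    obtain ⟨hz1, hz2⟩ := abs_le.1 hz
    have ha0 : (0 : ℝ) < a := by linarith
    have hb0 : (0 : ℝ) < b := by linarith
    have key := choose_mul_pow_mul_pow_le (a := a) (b := b) (by exact_mod_cast ha0)
      (by exact_mod_cast hb0) (p := (1 + ε) / 2) (q := (1 - ε) / 2)
      (by linarith [hε.1]) (by linarith [hε.2]) (by ring)
    rw [← hab] at key
    refine key.trans ?_
    rw [one_div, ← Real.sqrt_inv]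
    apply Real.sqrt_le_sqrt
    rw [div_le_iff₀ (by positivity), inv_mul_eq_div, le_div_iff₀ hn']
    have h4 : 3 * (n : ℝ) * n ≤ 16 * (a * b) := by nlinarith
    have h5 := Real.pi_gt_three
    nlinarith [mul_pos ha0 hb0]
  · positivity

theorem card_parity_window_le (S : Finset ℤ) (n : ℕ) {c R : ℝ} (hR : 0 ≤ R)
    (hS : ∀ z ∈ S, ((n : ℤ) + z) % 2 = 0 ∧ |(z : ℝ) + c| ≤ R) : (S.card : ℝ) ≤ R + 1 := by
  set u : ℝ := (n - c - R) / 2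
  set v : ℝ := (n - c + R) / 2
  have hle : S.card ≤ (Finset.Icc ⌈u⌉ ⌊v⌋).card := by
    refine Finset.card_le_card_of_injOn (fun z => ((n : ℤ) + z) / 2) ?_ ?_
    · intro z hz
      obtain ⟨h1, h2⟩ := hS z hz
      obtain ⟨h3, h4⟩ := abs_le.1 h2
      have h5 : ((((n : ℤ) + z) / 2 : ℤ) : ℝ) * 2 = n + z := by
        have : ((n : ℤ) + z) / 2 * 2 = n + z := by omega
        exact_mod_cast this
      simp only [Finset.coe_Icc, Set.mem_Icc, Int.ceil_le, Int.le_floor]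
      constructor
      · simp only [u]; linarith
      · simp only [v]; linarith
    · intro x hx y hy hxy
      have h1 := (hS x hx).1
      have h2 := (hS y hy).1
      simp only at hxy
      omega
  rw [Int.card_Icc] at hle
  have h1 : ((⌊v⌋ + 1 - ⌈u⌉).toNat : ℝ) ≤ R + 1 := by
    rcases le_total (⌊v⌋ + 1 - ⌈u⌉) 0 with h | h
    · rw [Int.toNat_of_nonpos h]; push_cast; linarith
    · have h2 : (((⌊v⌋ + 1 - ⌈u⌉).toNat : ℤ) : ℝ) = ((⌊v⌋ + 1 - ⌈u⌉ : ℤ) : ℝ) := by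
        rw [Int.toNat_of_nonneg h]
      rw [Int.cast_natCast] at h2
      rw [h2]
      push_cast
      have h3 := Int.floor_le v
      have h4 := Int.le_ceil u
      have h5 : v - u = R := by simp only [u, v]; ring
      linarith
  exact le_trans (by exact_mod_cast hle) h1

theorem sum_indicator_binPMF_le (T : Finset ℤ) {n : ℕ} {ε c R M : ℝ} (hR : 0 ≤ R) (hM : 0 ≤ M)
    (hb : ∀ z : ℤ, |(z : ℝ) + c| ≤ R → binPMF n ε z ≤ M) :
    (∑ y ∈ T, {z : ℤ | |(z : ℝ) + c| ≤ R}.indicator (fun z => binPMF n ε z) y) ≤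
      (R + 1) * M := by
  classical
  set S := T.filter (fun z => ((n : ℤ) + z) % 2 = 0 ∧ |(z : ℝ) + c| ≤ R)
  have hcard : (S.card : ℝ) ≤ R + 1 :=
    card_parity_window_le S n hR fun z hz => (Finset.mem_filter.1 hz).2
  calc _ ≤ ∑ y ∈ T, if ((n : ℤ) + y) % 2 = 0 ∧ |(y : ℝ) + c| ≤ R then M else 0 := by
        refine Finset.sum_le_sum fun y _ => ?_
        by_cases h1 : |(y : ℝ) + c| ≤ R
        · rw [Set.indicator_of_mem (by exact h1)]
          by_cases h2 : ((n : ℤ) + y) % 2 = 0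
          · rw [if_pos ⟨h2, h1⟩]
            exact hb y h1
          · rw [if_neg (fun h => h2 h.1), binPMF, if_neg (fun h => h2 h.1)]
        · rw [Set.indicator_of_notMem (by exact h1), if_neg (fun h => h1 h.2)]
    _ = S.card * M := by rw [← Finset.sum_filter, Finset.sum_const, nsmul_eq_mul]
    _ ≤ (R + 1) * M := mul_le_mul_of_nonneg_right hcard hM

theorem eventually_logb_two_le_sq :
    ∀ᶠ m : ℕ in Filter.atTop, Real.logb 2 m ≤ (m : ℝ) ^ 2 / 4096 := by
  filter_upwards [Filter.eventually_ge_atTop 8192] with m hm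
  have hm' : (8192 : ℝ) ≤ m := by exact_mod_cast hm
  have h1 : Real.log m ≤ m := (Real.log_le_sub_one_of_pos (by linarith)).trans (by linarith)
  have h2 := Real.log_two_gt_d9
  rw [Real.logb, div_le_iff₀ (by linarith)]
  nlinarith


theorem stmt_15 :
    ∃ m0 : ℕ, ∀ m : ℕ, m0 ≤ m → ∀ i : ℕ, (m : ℝ) / 2 ≤ (i : ℝ) → i ≤ m →
      ∀ ε : ℝ, ε ∈ Set.Icc (-1 : ℝ) 1 →
        |ε| ≤ 4 * Real.sqrt (Real.logb 2 m / (sRound m 1 : ℝ)) →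
        (∑ y ∈ Finset.Icc (-((sRound m 1 - sRound m i : ℕ) : ℤ)) ((sRound m 1 - sRound m i : ℕ) : ℤ),
            {z : ℤ | |(z : ℝ) + ε * (sRound m i : ℝ)| ≤
                4 * Real.sqrt (Real.logb 2 m * (sRound m i : ℝ))}.indicator
              (fun z => binPMF (sRound m 1 - sRound m i) ε z) y) ≤
          12 * (lRound m i : ℝ) * Real.sqrt (Real.logb 2 m) / m := by
  obtain ⟨N, hN⟩ := Filter.eventually_atTop.1 eventually_logb_two_le_sq
  refine ⟨max N 8, fun m hm i hi him ε hε hεb => ?_⟩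
  have hlog := hN m (le_trans (le_max_left _ _) hm)
  have hm8 : (8 : ℝ) ≤ m := by exact_mod_cast le_trans (le_max_right _ _) hm
  have hi1 : 1 ≤ i := by
    have : (0 : ℝ) < i := by linarith
    exact_mod_cast this
  have hs1 := two_mul_sRound (hi1.trans him)
  have hsi := two_mul_sRound him
  have hl1 : lRound m 1 = m := by unfold lRound; omega
  have hli : (lRound m i : ℝ) = m + 1 - i := by
    unfold lRound
    rw [Nat.cast_sub (by omega)]
    push_cast
    ring
  have hl1' : (1 : ℝ) ≤ lRound m i := by
    have : (i : ℝ) ≤ m := by exact_mod_cast him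
    linarith
  have hl2 : (lRound m i : ℝ) ≤ m / 2 + 1 := by linarith
  rw [hl1] at hs1
  set l : ℝ := (lRound m i : ℝ)
  set s : ℝ := (sRound m i : ℝ)
  set t : ℝ := (sRound m 1 : ℝ)
  set L : ℝ := Real.logb 2 m
  have hs0 : 0 < s := by nlinarith
  have hsl : s ≤ l ^ 2 := by nlinarith
  have hsu : s ≤ t - (m : ℝ) ^ 2 / 4 := by nlinarith
  have ht0 : 0 < t := by nlinarith
  have hst : s ≤ t := by nlinarith
  have hL1 : 1 ≤ L := by
    rw [Real.le_logb_iff_rpow_le (by norm_num) (by linarith)]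
    rw [Real.rpow_one]
    linarith
  have hnat : sRound m i ≤ sRound m 1 := by
    have : (sRound m i : ℝ) ≤ sRound m 1 := hst
    exact_mod_cast this
  have hn : ((sRound m 1 - sRound m i : ℕ) : ℝ) = t - s := Nat.cast_sub hnat
  set n := sRound m 1 - sRound m i
  have hnm : (m : ℝ) ^ 2 / 4 ≤ n := by linarith
  have hn0 : (0 : ℝ) < n := by nlinarith
  have hm0 : (0 : ℝ) < m := by linarith
  have htm : t ≤ (m : ℝ) ^ 2 := by nlinarith
  have hsqL : Real.sqrt L ≤ m / 64 := by
    rw [Real.sqrt_le_left (by positivity)]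
    linarith
  have hsqL1 : 1 ≤ Real.sqrt L := Real.one_le_sqrt.2 hL1
  have hsqs : Real.sqrt s ≤ l := by
    rw [Real.sqrt_le_left (by linarith)]
    exact hsl
  have hsqt : Real.sqrt t ≤ m := by
    rw [Real.sqrt_le_left (by linarith)]
    exact htm
  have hsqst : Real.sqrt s ≤ Real.sqrt t := Real.sqrt_le_sqrt hst
  have hshift : |ε * s| ≤ 4 * (Real.sqrt L * m) := by
    rw [abs_mul, abs_of_pos hs0]
    calc |ε| * s ≤ 4 * Real.sqrt (L / t) * t := mul_le_mul hεb hst hs0.le (by positivity)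
      _ = 4 * (Real.sqrt L * Real.sqrt t) := by
          have h := Real.mul_self_sqrt ht0.le
          have h' : 0 < Real.sqrt t := Real.sqrt_pos.2 ht0
          rw [Real.sqrt_div (by linarith)]
          nth_rewrite 2 [← h]
          field_simp
      _ ≤ _ := by gcongr
  have hR : Real.sqrt (L * s) = Real.sqrt L * Real.sqrt s := Real.sqrt_mul (by linarith) _
  have hsum := sum_indicator_binPMF_le (Finset.Icc (-(n : ℤ)) (n : ℤ)) (n := n) (ε := ε)
    (c := ε * s) (R := 4 * Real.sqrt (L * s)) (M := 2 / m) (by positivity) (by positivity) ?_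
  · refine hsum.trans ?_
    have h1 : 4 * Real.sqrt (L * s) + 1 ≤ 5 * (l * Real.sqrt L) := by
      have h2 := mul_le_mul_of_nonneg_left hsqs (Real.sqrt_nonneg L)
      have h3 := one_le_mul_of_one_le_of_one_le hsqL1 hl1'
      rw [hR]
      linarith
    calc (4 * Real.sqrt (L * s) + 1) * (2 / m) ≤ 5 * (l * Real.sqrt L) * (2 / m) := by gcongr
      _ = 10 * l * Real.sqrt L / m := by ring
      _ ≤ _ := by gcongr; norm_num
  · intro z hz
    have h1 : |(z : ℝ)| ≤ n / 2 := by
      have h2 : |(z : ℝ)| ≤ |(z : ℝ) + ε * s| + |ε * s| := by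
        have := abs_sub ((z : ℝ) + ε * s) (ε * s)
        simpa using this
      have h3 : Real.sqrt (L * s) ≤ Real.sqrt L * m := by
        rw [hR]
        gcongr
        linarith
      have h4 : Real.sqrt L * m ≤ m / 64 * m := by gcongr
      linarith
    refine (binPMF_le (by exact_mod_cast hn0) hε h1).trans ?_
    have h2 : (m : ℝ) / 2 ≤ Real.sqrt n := Real.le_sqrt_of_sq_le (by linarith)
    calc 1 / Real.sqrt n ≤ 1 / ((m : ℝ) / 2) := by gcongr
      _ = 2 / m := by field_simp
end
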